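/- arXiv:2401.01332 — 3 statements merged into one kernel-verified Lean document; each statement's English description precedes it below -/
import Mathlib

section
/- If H is a bipartite graph with parts A, B of size 4 and minimum degree at least 2, then every vertex of H is incident with at least two edges each of which is contained in a perfect matching of H. -/
/-!
A `(4,2)`-bigraph encoded by `N : Fin 4 → Finset (Fin 4)` (part `A` indexes the
domain, part `B` the codomain).  Every vertex (in either part) is incident with
at least two edges each contained in a perfect matching.
-/

/-- The edge `ab` of the bigraph `N` lies in a perfect matching. -/
def Extends (N : Fin 4 → Finset (Fin 4)) (a b : Fin 4) : Prop :=
  ∃ f : Fin 4 ≃ Fin 4, (∀ x, f x ∈ N x) ∧ f a = b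

/-- The four given vertices are pairwise distinct, hence exhaust `Fin 4`. -/
def Enumerates (a x y z : Fin 4) : Prop :=
  (a ≠ x ∧ a ≠ y ∧ a ≠ z ∧ x ≠ y ∧ x ≠ z ∧ y ≠ z) ∧ ∀ t, t = a ∨ t = x ∨ t = y ∨ t = z

lemma exists_enumerates (a : Fin 4) : ∃ x y z, Enumerates a x y z := by
  unfold Enumerates
  revert a
  decide

lemma Enumerates.swap_left {a x y z : Fin 4} (h : Enumerates a x y z) : Enumerates a y x z := by
  unfold Enumerates at *
  grind

lemma Enumerates.swap_right {a x y z : Fin 4} (h : Enumerates a x y z) : Enumerates a x z y := by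
  unfold Enumerates at *
  grind

lemma Enumerates.swap_first {a x y z : Fin 4} (h : Enumerates a x y z) : Enumerates x a y z := by
  unfold Enumerates at *
  grind

lemma Extends.of_mem {N : Fin 4 → Finset (Fin 4)} {a x y z b p q r : Fin 4}
    (hrow : Enumerates a x y z) (hcol : Enumerates b p q r)
    (ha : b ∈ N a) (hx : p ∈ N x) (hy : q ∈ N y) (hz : r ∈ N z) : Extends N a b := by
  obtain ⟨hne, hall⟩ := hrow
  obtain ⟨hne', -⟩ := hcol
  let f : Fin 4 → Fin 4 := fun t => if t = a then b else if t = x then p else if t = y then q else r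
  have hf : Function.Injective f := by
    intro s t hst
    have := hall s
    have := hall t
    grind
  refine ⟨Equiv.ofBijective f (Finite.injective_iff_bijective.mp hf), fun t => ?_, ?_⟩
  · have := hall t
    simp only [Equiv.ofBijective_apply]
    grind
  · simp [f]

/-- If `N x` and `N y` avoid the columns `d` and `e`, then `ad` lies in a perfect matching. -/
lemma extends_of_confined {N : Fin 4 → Finset (Fin 4)}
    (hA : ∀ a p, ∃ b ∈ N a, b ≠ p) (hB : ∀ b x, ∃ a, b ∈ N a ∧ a ≠ x) {a x y z b c d e : Fin 4}
    (hrow : Enumerates a x y z) (hcol : Enumerates d e b c)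
    (hxd : d ∉ N x) (hxe : e ∉ N x) (hyd : d ∉ N y) (hye : e ∉ N y) : Extends N a d := by
  have hN : ∀ t, d ∉ N t → e ∉ N t → b ∈ N t ∧ c ∈ N t := by
    intro t htd hte
    obtain ⟨p, hp, hpb⟩ := hA t b
    obtain ⟨q, hq, hqc⟩ := hA t c
    have := hcol.2 p
    have := hcol.2 q
    grind
  have hM : ∀ s, s ∉ N x → s ∉ N y → s ∈ N a ∧ s ∈ N z := by
    intro s hsx hsy
    obtain ⟨t, ht, hta⟩ := hB s a
    obtain ⟨u, hu, huz⟩ := hB s z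
    have := hrow.2 t
    have := hrow.2 u
    grind
  exact .of_mem hrow.swap_right.swap_left hcol (hM d hxd hyd).1 (hM e hxe hye).2
    (hN x hxd hxe).1 (hN y hyd hye).2

/-- An edge in no perfect matching is witnessed by two rows confined to two columns. -/
lemma exists_confined_of_not_extends {N : Fin 4 → Finset (Fin 4)}
    (hA : ∀ a p, ∃ b ∈ N a, b ≠ p) (hB : ∀ b x, ∃ a, b ∈ N a ∧ a ≠ x) {a b : Fin 4}
    (hab : b ∈ N a) (h : ¬ Extends N a b) :
    ∃ x y z c d e, Enumerates a x y z ∧ Enumerates d e b c ∧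
      d ∉ N x ∧ e ∉ N x ∧ d ∉ N y ∧ e ∉ N y := by
  by_contra hcon
  obtain ⟨x, y, z, hrow⟩ := exists_enumerates a
  obtain ⟨p, q, r, hcol⟩ := exists_enumerates b
  have hmatch : ∀ {p q r}, Enumerates b p q r → ¬ (p ∈ N x ∧ q ∈ N y ∧ r ∈ N z) :=
    fun hc hm => h (.of_mem hrow hc hab hm.1 hm.2.1 hm.2.2)
  have hconf : ∀ {x y z c d e}, Enumerates a x y z → Enumerates b c d e →
      d ∈ N x ∨ e ∈ N x ∨ d ∈ N y ∨ e ∈ N y := by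
    intro x y z c d e hr hc
    by_contra hm
    simp only [not_or] at hm
    exact hcon ⟨x, y, z, c, d, e, hr, hc.swap_left.swap_right.swap_first.swap_left, hm⟩
  have hnonempty : ∀ t, p ∈ N t ∨ q ∈ N t ∨ r ∈ N t := by
    intro t
    obtain ⟨s, hs, hsb⟩ := hA t b
    have := hcol.2 s
    grind
  have hcover : ∀ s, s ∈ N x ∨ s ∈ N y ∨ s ∈ N z := by
    intro s
    obtain ⟨t, ht, hta⟩ := hB s a
    have := hrow.2 t
    grind
  have hx := hnonempty x
  have hy := hnonempty y
  have hz := hnonempty z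
  have hp := hcover p
  have hq := hcover q
  have hr := hcover r
  have m₁ := hmatch hcol
  have m₂ := hmatch hcol.swap_left
  have m₃ := hmatch hcol.swap_right
  have m₄ := hmatch hcol.swap_left.swap_right
  have m₅ := hmatch hcol.swap_right.swap_left
  have m₆ := hmatch hcol.swap_left.swap_right.swap_left
  have hpair : ∀ {x y z}, Enumerates a x y z → (q ∈ N x ∨ r ∈ N x ∨ q ∈ N y ∨ r ∈ N y) ∧
      (p ∈ N x ∨ r ∈ N x ∨ p ∈ N y ∨ r ∈ N y) ∧ (p ∈ N x ∨ q ∈ N x ∨ p ∈ N y ∨ q ∈ N y) :=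
    fun hr => ⟨hconf hr hcol, hconf hr hcol.swap_left, hconf hr hcol.swap_right.swap_left⟩
  have c₁ := hpair hrow
  have c₂ := hpair hrow.swap_right
  have c₃ := hpair hrow.swap_left.swap_right
  clear hA hB hab h hcon hmatch hconf hnonempty hcover hpair hrow hcol
  grind (splits := 20)

lemma exists_two_extends {N : Fin 4 → Finset (Fin 4)}
    (hA : ∀ a p, ∃ b ∈ N a, b ≠ p) (hB : ∀ b x, ∃ a, b ∈ N a ∧ a ≠ x) (a : Fin 4) :
    ∃ b₁ b₂, b₁ ≠ b₂ ∧ Extends N a b₁ ∧ Extends N a b₂ := by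
  by_cases hall : ∀ b ∈ N a, Extends N a b
  · obtain ⟨b, hb, -⟩ := hA a 0
    obtain ⟨c, hc, hcb⟩ := hA a b
    exact ⟨c, b, hcb, hall c hc, hall b hb⟩
  · push Not at hall
    obtain ⟨b, hb, hbad⟩ := hall
    obtain ⟨x, y, z, c, d, e, hrow, hcol, hxd, hxe, hyd, hye⟩ :=
      exists_confined_of_not_extends hA hB hb hbad
    exact ⟨d, e, hcol.1.1, extends_of_confined hA hB hrow hcol hxd hxe hyd hye,
      extends_of_confined hA hB hrow hcol.swap_first hxe hxd hye hyd⟩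

theorem stmt6 (N : Fin 4 → Finset (Fin 4))
    (hA : ∀ a, 2 ≤ (N a).card)
    (hB : ∀ b : Fin 4, 2 ≤ (Finset.univ.filter (fun a => b ∈ N a)).card) :
    (∀ a : Fin 4, ∃ b₁ b₂ : Fin 4, b₁ ≠ b₂ ∧
      (∃ f : Fin 4 ≃ Fin 4, (∀ x, f x ∈ N x) ∧ f a = b₁) ∧
      (∃ f : Fin 4 ≃ Fin 4, (∀ x, f x ∈ N x) ∧ f a = b₂)) ∧
    (∀ b : Fin 4, ∃ a₁ a₂ : Fin 4, a₁ ≠ a₂ ∧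
      (∃ f : Fin 4 ≃ Fin 4, (∀ x, f x ∈ N x) ∧ f a₁ = b) ∧
      (∃ f : Fin 4 ≃ Fin 4, (∀ x, f x ∈ N x) ∧ f a₂ = b)) := by
  have hA' : ∀ a p, ∃ b ∈ N a, b ≠ p := fun a p => Finset.exists_mem_ne (hA a) p
  have hB' : ∀ b x, ∃ a, b ∈ N a ∧ a ≠ x := fun b x => by
    simpa using Finset.exists_mem_ne (hB b) x
  refine ⟨exists_two_extends hA' hB', fun b => ?_⟩
  let M : Fin 4 → Finset (Fin 4) := fun b => Finset.univ.filter (fun a => b ∈ N a)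
  have hM : ∀ {a}, Extends M b a → ∃ f : Fin 4 ≃ Fin 4, (∀ x, f x ∈ N x) ∧ f a = b := by
    rintro a ⟨f, hf, rfl⟩
    refine ⟨f.symm, fun x => ?_, f.symm_apply_apply b⟩
    simpa [M] using hf (f.symm x)
  obtain ⟨a₁, a₂, hne, h₁, h₂⟩ := exists_two_extends (N := M)
    (by simpa [M] using hB') (by simpa [M] using hA') b
  exact ⟨a₁, a₂, hne, hM h₁, hM h₂⟩
end

section
/- Let H be a bipartite graph with parts A, B of size 8 and minimum degree at least 4. Suppose H contains a 10-cycle C and a matching M of size 5. Then there exists a subgraph J of H containing two vertex-disjoint paths on 3 vertices from C and two disjoint edges from M, such that H − E(J) has a perfect matching. -/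
/-- Two edges of a bigraph (pairs with first coordinate in part `A`, second in
part `B`) form a path on 3 vertices iff they share exactly one endpoint. -/
def IsP3 {n : ℕ} (e f : Fin n × Fin n) : Prop :=
  (e.1 = f.1 ∧ e.2 ≠ f.2) ∨ (e.2 = f.2 ∧ e.1 ≠ f.1)

/-- Two edges of a bigraph are vertex-disjoint. -/
def VDisj {n : ℕ} (e f : Fin n × Fin n) : Prop :=
  e.1 ≠ f.1 ∧ e.2 ≠ f.2

/-! Edges of a bigraph on `Fin 8 × Fin 8` are pairs. A list `J` of edges is to be removed from a
graph of minimum degree at least 4 of which only a list `C` of edges is known; `robust C J` is a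
finite condition under which a perfect matching survives. -/

/-- The vertices joined to `S` by an edge of `C` that is not in `J`. -/
def survivingNeighbors (C J : List (Fin 8 × Fin 8)) (S : List (Fin 8)) : List (Fin 8) :=
  ((C.filter fun e => e.1 ∈ S ∧ e ∉ J).map Prod.snd).dedup

/-- A necessary condition for `S` to violate Hall's condition once `J` is removed.
Its first clause is redundant and only speeds up evaluation. -/
def blocks (C J : List (Fin 8 × Fin 8)) (S : List (Fin 8)) : Bool :=
  S.all (fun a => 5 ≤ S.length + (J.filter fun e => e.1 = a).length) &&
  ((survivingNeighbors C J S).length < S.length &&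
  S.all fun a => 5 ≤ S.length +
    (J.filter fun e => e.1 = a ∧ e.2 ∉ survivingNeighbors C J S).length)

/-- No set of at most four vertices on the left violates Hall's condition after removing `J`. -/
def robustLeft (C J : List (Fin 8 × Fin 8)) : Bool :=
  (J.map Prod.fst).dedup.sublists.all fun S => S.length = 0 || 4 < S.length || !blocks C J S

/-- `robustLeft` on both sides. -/
def robust (C J : List (Fin 8 × Fin 8)) : Bool :=
  robustLeft C J.dedup && robustLeft (C.map Prod.swap) (J.dedup.map Prod.swap)

theorem robustLeft_eq_false_of_hall_violation {N : Fin 8 → Finset (Fin 8)}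
    (hN : ∀ a, 4 ≤ (N a).card) {C J : List (Fin 8 × Fin 8)} (hC : ∀ e ∈ C, e.2 ∈ N e.1)
    {S T : Finset (Fin 8)} (hS : S.card ≤ 4) (hST : 9 ≤ S.card + T.card)
    (hJ : ∀ a ∈ S, ∀ b ∈ T, b ∈ N a → (a, b) ∈ J) : robustLeft C J = false := by
  have hTc : Tᶜ.card = 8 - T.card := by simp [Finset.card_compl]
  have hT8 : T.card ≤ 8 := by simpa using Finset.card_le_univ T
  have hdeg : ∀ a ∈ S, 5 ≤ S.card + (T.filter fun b => (a, b) ∈ J).card := by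
    intro a ha
    have hsub : N a ⊆ Tᶜ ∪ T.filter fun b => (a, b) ∈ J := by
      intro b hb
      by_cases hbT : b ∈ T
      · simp [hbT, hJ a ha b hbT hb]
      · simp [hbT]
    have := (Finset.card_le_card hsub).trans (Finset.card_union_le _ _)
    have := hN a
    omega
  have hSJ : ∀ a ∈ S, a ∈ J.map Prod.fst := by
    intro a ha
    have h := hdeg a ha
    obtain ⟨b, hb⟩ : (T.filter fun b => (a, b) ∈ J).Nonempty := by
      rw [← Finset.card_pos]; omega
    exact List.mem_map.2 ⟨(a, b), (Finset.mem_filter.1 hb).2, rfl⟩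
  set L := (J.map Prod.fst).dedup.filter (· ∈ S) with hL
  have hmem : ∀ a, a ∈ L ↔ a ∈ S := by
    intro a
    simp only [hL, List.mem_filter, List.mem_dedup, decide_eq_true_eq]
    exact ⟨fun h => h.2, fun h => ⟨hSJ a h, h⟩⟩
  have hlen : L.length = S.card := by
    rw [← List.toFinset_card_of_nodup ((List.nodup_dedup _).filter _)]
    congr 1
    ext a
    rw [List.mem_toFinset]
    exact hmem a
  have hX : ∀ b ∈ survivingNeighbors C J L, b ∉ T := by
    intro b hb hbT
    simp only [survivingNeighbors, List.mem_dedup, List.mem_map, List.mem_filter,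
      decide_eq_true_eq] at hb
    obtain ⟨e, ⟨heC, heL, heJ⟩, rfl⟩ := hb
    exact heJ (hJ e.1 ((hmem _).1 heL) e.2 hbT (hC e heC))
  have hXlen : (survivingNeighbors C J L).length < L.length := by
    have h1 : (survivingNeighbors C J L).toFinset ⊆ Tᶜ := by
      intro b hb
      simpa using hX b (List.mem_toFinset.1 hb)
    have h2 := Finset.card_le_card h1
    rw [List.toFinset_card_of_nodup (by exact List.nodup_dedup _)] at h2
    omega
  have hcount : ∀ a ∈ L, 5 ≤ L.length +
      (J.filter fun e => e.1 = a ∧ e.2 ∉ survivingNeighbors C J L).length := by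
    intro a ha
    have h1 : (T.filter fun b => (a, b) ∈ J).card ≤
        (J.filter fun e => e.1 = a ∧ e.2 ∉ survivingNeighbors C J L).length := by
      refine le_trans ?_ (List.toFinset_card_le _)
      refine Finset.card_le_card_of_injOn (fun b => (a, b)) ?_ ?_
      · intro b hb
        have hbT := Finset.mem_filter.1 hb
        have : b ∉ survivingNeighbors C J L := fun h => hX b h hbT.1
        simp [hbT.2, this]
      · intro b _ c _ h
        exact (Prod.mk.inj h).2
    have := hdeg a ((hmem a).1 ha)
    omega
  have hdegree : ∀ a ∈ L, 5 ≤ L.length + (J.filter fun e => e.1 = a).length := by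
    intro a ha
    have h := hcount a ha
    have : (J.filter fun e => e.1 = a ∧ e.2 ∉ survivingNeighbors C J L).length ≤
        (J.filter fun e => e.1 = a).length :=
      (List.monotone_filter_right J (by intro e; simp; tauto)).length_le
    omega
  have hblocks : blocks C J L = true := by
    simp only [blocks, Bool.and_eq_true, List.all_eq_true, decide_eq_true_eq]
    exact ⟨hdegree, hXlen, hcount⟩
  rw [← Bool.not_eq_true]
  intro h
  have := List.all_eq_true.1 h L (List.mem_sublists.2 List.filter_sublist)
  simp only [hblocks, Bool.not_true, Bool.or_false, Bool.or_eq_true, decide_eq_true_eq] at this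
  omega

theorem exists_perfectMatching_of_robust {N : Fin 8 → Finset (Fin 8)}
    (hA : ∀ a, 4 ≤ (N a).card)
    (hB : ∀ b : Fin 8, 4 ≤ (Finset.univ.filter fun a => b ∈ N a).card)
    {C J : List (Fin 8 × Fin 8)} (hC : ∀ e ∈ C, e.2 ∈ N e.1) (h : robust C J = true) :
    ∃ f : Fin 8 ≃ Fin 8, ∀ z, f z ∈ N z ∧ (z, f z) ∉ J := by
  rw [robust, Bool.and_eq_true] at h
  suffices hall : ∀ S : Finset (Fin 8),
      S.card ≤ (S.biUnion fun a => (N a).filter fun b => (a, b) ∉ J).card by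
    obtain ⟨f, hf, hfN⟩ := (Finset.all_card_le_biUnion_card_iff_exists_injective _).1 hall
    refine ⟨Equiv.ofBijective f (Finite.injective_iff_bijective.1 hf), fun z => ?_⟩
    simpa using hfN z
  intro S
  by_contra! hS
  set U := S.biUnion fun a => (N a).filter fun b => (a, b) ∉ J with hU
  have hS8 : S.card ≤ 8 := by simpa using Finset.card_le_univ S
  have hUc : Uᶜ.card = 8 - U.card := by simp [Finset.card_compl]
  obtain ⟨T, hTU, hT⟩ := Finset.exists_subset_card_eq (s := Uᶜ) (n := 9 - S.card) (by omega)
  have hJ : ∀ a ∈ S, ∀ b ∈ T, b ∈ N a → (a, b) ∈ J := by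
    intro a ha b hb hab
    by_contra hJ
    refine Finset.mem_compl.1 (hTU hb) ?_
    simp only [hU, Finset.mem_biUnion, Finset.mem_filter]
    exact ⟨a, ha, hab, hJ⟩
  rcases le_or_gt S.card 4 with h4 | h4
  · have := robustLeft_eq_false_of_hall_violation hA hC (J := J.dedup) h4 (T := T) (by omega)
      (by simpa using hJ)
    simp [this] at h
  · have := robustLeft_eq_false_of_hall_violation hB (C := C.map Prod.swap)
      (J := J.dedup.map Prod.swap) (S := T) (T := S)
      (by
        intro e he
        obtain ⟨e₀, he₀, rfl⟩ := List.mem_map.1 he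
        simpa using hC e₀ he₀)
      (by omega) (by omega)
      (by
        intro b hb a ha hab
        refine List.mem_map.2 ⟨(a, b), ?_, rfl⟩
        simpa using hJ a ha b hb (by simpa using hab))
    simp [this] at h

/-- The 10-cycle through the first five vertices of both parts. -/
def tenCycle : List (Fin 8 × Fin 8) :=
  [(0, 0), (1, 0), (1, 1), (2, 1), (2, 2), (3, 2), (3, 3), (4, 3), (4, 4), (0, 4)]

/-- Seven of the 25 choices of two disjoint paths on 3 vertices in `tenCycle`; they suffice. -/
def cherryPairs : List ((Fin 8 × Fin 8) × (Fin 8 × Fin 8) × (Fin 8 × Fin 8) × (Fin 8 × Fin 8)) :=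
  [((4, 4), (0, 4), (1, 0), (1, 1)),
   ((1, 1), (2, 1), (0, 4), (0, 0)),
   ((1, 0), (1, 1), (2, 2), (3, 2)),
   ((2, 2), (3, 2), (4, 3), (4, 4)),
   ((3, 2), (3, 3), (1, 1), (2, 1)),
   ((3, 2), (3, 3), (4, 4), (0, 4)),
   ((0, 0), (1, 0), (4, 3), (4, 4))]

/-- Some pair of paths can be removed together with the edges `p` and `q`. -/
def Good (p q : Fin 8 × Fin 8) : Prop :=
  ∃ c ∈ cherryPairs, robust tenCycle [c.1, c.2.1, c.2.2.1, c.2.2.2, p, q] = true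

instance (p q : Fin 8 × Fin 8) : Decidable (Good p q) := by unfold Good; infer_instance

/-- The position of the `i`-th vertex of the cycle. -/
def pos (i : Fin 5) : Fin 8 := i.castLE (by decide)

theorem pos_zero : pos 0 = 0 := rfl

theorem good_inside : ∀ j ∈ [(1 : Fin 5), 2], ∀ b c : Fin 5, b ≠ c →
    Good (0, pos b) (pos j, pos c) := by
  decide +kernel

theorem good_left : ∀ c d : Fin 5, c ≠ 0 → (c, d) ≠ (2, 1) → (c, d) ≠ (3, 3) →
    Good (0, 5) (pos c, pos d) := by
  decide +kernel

theorem good_right : ∀ c d : Fin 5, d ≠ 0 → (c, d) ≠ (2, 2) → (c, d) ≠ (4, 3) →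
    Good (5, 0) (pos c, pos d) := by
  decide +kernel

theorem good_left_right : ∀ b : Fin 5, b ≠ 2 → Good (0, 5) (5, pos b) := by
  decide +kernel

theorem cherryPairs_spec : ∀ c ∈ cherryPairs,
    (c.1 ∈ tenCycle ∧ c.2.1 ∈ tenCycle ∧ c.2.2.1 ∈ tenCycle ∧ c.2.2.2 ∈ tenCycle) ∧
    IsP3 c.1 c.2.1 ∧ IsP3 c.2.2.1 c.2.2.2 ∧
    VDisj c.1 c.2.2.1 ∧ VDisj c.1 c.2.2.2 ∧ VDisj c.2.1 c.2.2.1 ∧ VDisj c.2.1 c.2.2.2 := by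
  unfold IsP3 VDisj
  decide

theorem mem_tenCycle : ∀ e ∈ tenCycle,
    ∃ i : Fin 5, e = (pos i, pos i) ∨ e = (pos (i + 1), pos i) := by
  decide

/-- Two disjoint paths on 3 vertices of the cycle on `x`, `y` can be removed together with `p`
and `q` so that a perfect matching survives. -/
def Removable (N : Fin 8 → Finset (Fin 8)) (x y : Fin 5 → Fin 8) (p q : Fin 8 × Fin 8) : Prop :=
  ∃ J : Finset (Fin 8 × Fin 8),
    (∀ p ∈ J, p.2 ∈ N p.1) ∧
    (∃ e₁ e₂ e₃ e₄ : Fin 8 × Fin 8,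
      e₁ ∈ J ∧ e₂ ∈ J ∧ e₃ ∈ J ∧ e₄ ∈ J ∧
      (∃ i : Fin 5, e₁ = (x i, y i) ∨ e₁ = (x (i + 1), y i)) ∧
      (∃ i : Fin 5, e₂ = (x i, y i) ∨ e₂ = (x (i + 1), y i)) ∧
      (∃ i : Fin 5, e₃ = (x i, y i) ∨ e₃ = (x (i + 1), y i)) ∧
      (∃ i : Fin 5, e₄ = (x i, y i) ∨ e₄ = (x (i + 1), y i)) ∧
      IsP3 e₁ e₂ ∧ IsP3 e₃ e₄ ∧
      VDisj e₁ e₃ ∧ VDisj e₁ e₄ ∧ VDisj e₂ e₃ ∧ VDisj e₂ e₄) ∧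
    p ∈ J ∧ q ∈ J ∧
    ∃ f : Fin 8 ≃ Fin 8, ∀ z, f z ∈ N z ∧ (z, f z) ∉ J

theorem Removable.symm {N : Fin 8 → Finset (Fin 8)} {x y : Fin 5 → Fin 8}
    {p q : Fin 8 × Fin 8} (h : Removable N x y p q) : Removable N x y q p := by
  obtain ⟨J, h1, h2, hp, hq, h3⟩ := h
  exact ⟨J, h1, h2, hq, hp, h3⟩

theorem IsP3.prodMap {n : ℕ} {e f : Fin n × Fin n} (h : IsP3 e f) (σ τ : Equiv.Perm (Fin n)) :
    IsP3 (e.map σ τ) (f.map σ τ) := by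
  simpa [IsP3] using h

theorem VDisj.prodMap {n : ℕ} {e f : Fin n × Fin n} (h : VDisj e f) (σ τ : Equiv.Perm (Fin n)) :
    VDisj (e.map σ τ) (f.map σ τ) := by
  simpa [VDisj] using h

theorem exists_perm_extending {x : Fin 5 → Fin 8} (hx : Function.Injective x) {u : Fin 8}
    (hu : u ∉ Set.range x) (k : Fin 5) :
    ∃ σ : Equiv.Perm (Fin 8), (∀ i, σ (pos i) = x (i + k)) ∧ σ 5 = u := by
  have hxk : Function.Injective fun i => x (i + k) := hx.comp (add_left_injective k)
  have huk : u ∉ Set.range fun i => x (i + k) := fun ⟨i, hi⟩ => hu ⟨i + k, hi⟩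
  let g : Fin 6 ↪ Fin 8 := ⟨Fin.snoc (fun i => x (i + k)) u,
    Fin.snoc_injective_iff.2 ⟨hxk, huk⟩⟩
  obtain ⟨σ, hσ⟩ := ((Equiv.Perm.isMultiplyPretransitive (Fin 8) 6).exists_smul_eq
    (Fin.castLEEmb (by decide : 6 ≤ 8)) g)
  refine ⟨σ, fun i => ?_, ?_⟩
  · have := DFunLike.congr_fun hσ i.castSucc
    simpa [g, pos] using this
  · have := DFunLike.congr_fun hσ (Fin.last 5)
    exact this.trans (Fin.snoc_last (α := fun _ => Fin 8) u fun i => x (i + k))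

theorem exists_notMem_range (x : Fin 5 → Fin 8) : ∃ u, u ∉ Set.range x := by
  by_contra! h
  simpa using Fintype.card_le_of_surjective x h

section

variable {N : Fin 8 → Finset (Fin 8)} (hA : ∀ a, 4 ≤ (N a).card)
  (hB : ∀ b : Fin 8, 4 ≤ (Finset.univ.filter fun a => b ∈ N a).card) {x y : Fin 5 → Fin 8}
  (hx : Function.Injective x) (hy : Function.Injective y)
  (hC1 : ∀ i, y i ∈ N (x i)) (hC2 : ∀ i, y i ∈ N (x (i + 1)))
include hA hB hC1 hC2

theorem removable_of_good {k : Fin 5} {σ τ : Equiv.Perm (Fin 8)}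
    (hσ : ∀ i, σ (pos i) = x (i + k)) (hτ : ∀ i, τ (pos i) = y (i + k)) {p q : Fin 8 × Fin 8}
    (hp : τ p.2 ∈ N (σ p.1)) (hq : τ q.2 ∈ N (σ q.1)) (h : Good p q) :
    Removable N x y (p.map σ τ) (q.map σ τ) := by
  obtain ⟨c, hc, hrob⟩ := h
  obtain ⟨⟨c1, c2, c3, c4⟩, p1, p2, v1, v2, v3, v4⟩ := cherryPairs_spec c hc
  have hcyc : ∀ e ∈ tenCycle, ∃ i : Fin 5,
      e.map σ τ = (x i, y i) ∨ e.map σ τ = (x (i + 1), y i) := by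
    intro e he
    obtain ⟨i, rfl | rfl⟩ := mem_tenCycle e he
    · exact ⟨i + k, Or.inl (by simp [hσ, hτ])⟩
    · exact ⟨i + k, Or.inr (by simp [hσ, hτ, add_right_comm])⟩
  have hedge : ∀ e ∈ tenCycle, τ e.2 ∈ N (σ e.1) := by
    intro e he
    obtain ⟨i, hi | hi⟩ := hcyc e he <;> obtain ⟨h1, h2⟩ := Prod.ext_iff.1 hi
    · simp only [Prod.map_fst, Prod.map_snd] at h1 h2
      rw [h1, h2]; exact hC1 i
    · simp only [Prod.map_fst, Prod.map_snd] at h1 h2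
      rw [h1, h2]; exact hC2 i
  set L := [c.1, c.2.1, c.2.2.1, c.2.2.2, p, q] with hL
  obtain ⟨f, hf⟩ := exists_perfectMatching_of_robust (N := fun a => (N (σ a)).map τ.symm.toEmbedding)
    (by simpa using fun a => hA (σ a))
    (by
      intro b
      refine (hB (τ b)).trans_eq ?_
      refine Finset.card_equiv σ.symm fun a => ?_
      simp [Finset.mem_map_equiv])
    (C := tenCycle) (by simpa [Finset.mem_map_equiv] using hedge) hrob
  refine ⟨(L.map (Prod.map σ τ)).toFinset, ?_, ?_, ?_, ?_, (σ.symm.trans f).trans τ, fun z => ?_⟩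
  · simp only [List.mem_toFinset, List.mem_map]
    rintro _ ⟨e, he, rfl⟩
    simp only [hL, List.mem_cons, List.not_mem_nil, or_false] at he
    rcases he with rfl | rfl | rfl | rfl | rfl | rfl
    exacts [hedge _ c1, hedge _ c2, hedge _ c3, hedge _ c4, hp, hq]
  · refine ⟨c.1.map σ τ, c.2.1.map σ τ, c.2.2.1.map σ τ, c.2.2.2.map σ τ, by simp [hL],
      by simp [hL], by simp [hL], by simp [hL], hcyc _ c1, hcyc _ c2, hcyc _ c3, hcyc _ c4,
      p1.prodMap σ τ, p2.prodMap σ τ, v1.prodMap σ τ, v2.prodMap σ τ, v3.prodMap σ τ,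
      v4.prodMap σ τ⟩
  · simp [hL]
  · simp [hL]
  · obtain ⟨h1, h2⟩ := hf (σ.symm z)
    rw [Finset.mem_map_equiv] at h1
    refine ⟨by simpa using h1, fun hmem => h2 ?_⟩
    obtain ⟨e, he, heq⟩ := List.mem_map.1 (List.mem_toFinset.1 hmem)
    obtain ⟨h3, h4⟩ := Prod.ext_iff.1 heq
    have : e = (σ.symm z, f (σ.symm z)) :=
      Prod.ext (by simpa [Equiv.eq_symm_apply] using h3) (by simpa using h4)
    rwa [← this]

include hx hy

theorem removable_inside {a b c d : Fin 5} (hab : y b ∈ N (x a)) (hcd : y d ∈ N (x c))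
    (hac : a ≠ c) (hbd : b ≠ d) : Removable N x y (x a, y b) (x c, y d) := by
  wlog hj : c - a ∈ [(1 : Fin 5), 2] generalizing a b c d
  · refine (this hcd hab hac.symm hbd.symm ?_).symm
    revert hac hj
    clear * -
    revert a c
    decide
  obtain ⟨u, hu⟩ := exists_notMem_range x
  obtain ⟨v, hv⟩ := exists_notMem_range y
  obtain ⟨σ, hσ, -⟩ := exists_perm_extending hx hu a
  obtain ⟨τ, hτ, -⟩ := exists_perm_extending hy hv a
  have hσ0 : σ 0 = x a := by simpa [pos_zero] using hσ 0
  have := removable_of_good hA hB hC1 hC2 hσ hτ (p := (0, pos (b - a)))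
    (q := (pos (c - a), pos (d - a))) (by simpa [hσ0, hτ] using hab) (by simpa [hσ, hτ] using hcd)
    (good_inside _ hj _ _ (by simpa using hbd))
  simpa [hσ, hτ, hσ0] using this

theorem removable_left {a c d : Fin 5} {v : Fin 8} (hv : v ∉ Set.range y) (hav : v ∈ N (x a))
    (hcd : y d ∈ N (x c)) (hac : c ≠ a) (h1 : (c - a, d - a) ≠ (2, 1))
    (h2 : (c - a, d - a) ≠ (3, 3)) : Removable N x y (x a, v) (x c, y d) := by
  obtain ⟨u, hu⟩ := exists_notMem_range x
  obtain ⟨σ, hσ, -⟩ := exists_perm_extending hx hu a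
  obtain ⟨τ, hτ, hτ5⟩ := exists_perm_extending hy hv a
  have hσ0 : σ 0 = x a := by simpa [pos_zero] using hσ 0
  have := removable_of_good hA hB hC1 hC2 hσ hτ (p := (0, 5))
    (q := (pos (c - a), pos (d - a))) (by simpa [hσ0, hτ5] using hav)
    (by simpa [hσ, hτ] using hcd) (good_left _ _ (by simpa [sub_eq_zero] using hac) h1 h2)
  simpa [hσ, hτ, hσ0, hτ5] using this

theorem removable_right {b c d : Fin 5} {u : Fin 8} (hu : u ∉ Set.range x) (hub : y b ∈ N u)
    (hcd : y d ∈ N (x c)) (hbd : d ≠ b) (h1 : (c - b, d - b) ≠ (2, 2))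
    (h2 : (c - b, d - b) ≠ (4, 3)) : Removable N x y (u, y b) (x c, y d) := by
  obtain ⟨v, hv⟩ := exists_notMem_range y
  obtain ⟨σ, hσ, hσ5⟩ := exists_perm_extending hx hu b
  obtain ⟨τ, hτ, -⟩ := exists_perm_extending hy hv b
  have hτ0 : τ 0 = y b := by simpa [pos_zero] using hτ 0
  have := removable_of_good hA hB hC1 hC2 hσ hτ (p := (5, 0))
    (q := (pos (c - b), pos (d - b))) (by simpa [hτ0, hσ5] using hub)
    (by simpa [hσ, hτ] using hcd) (good_right _ _ (by simpa [sub_eq_zero] using hbd) h1 h2)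
  simpa [hσ, hτ, hτ0, hσ5] using this

theorem removable_left_right {a b : Fin 5} {u v : Fin 8} (hu : u ∉ Set.range x)
    (hv : v ∉ Set.range y) (hav : v ∈ N (x a)) (hub : y b ∈ N u) (hab : b - a ≠ 2) :
    Removable N x y (x a, v) (u, y b) := by
  obtain ⟨σ, hσ, hσ5⟩ := exists_perm_extending hx hu a
  obtain ⟨τ, hτ, hτ5⟩ := exists_perm_extending hy hv a
  have hσ0 : σ 0 = x a := by simpa [pos_zero] using hσ 0
  have := removable_of_good hA hB hC1 hC2 hσ hτ (p := (0, 5)) (q := (5, pos (b - a)))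
    (by simpa [hσ0, hτ5] using hav) (by simpa [hσ5, hτ] using hub) (good_left_right _ hab)
  simpa [hτ, hσ0, hτ5, hσ5] using this

end

theorem two_le_card_filter_mem_range {x : Fin 5 → Fin 8} (hx : Function.Injective x)
    {m : Fin 5 → Fin 8} (hm : Function.Injective m) :
    2 ≤ (Finset.univ.filter fun i => m i ∈ Set.range x).card := by
  classical
  have h1 := Finset.card_filter_add_card_filter_not (s := Finset.univ)
    (fun i => m i ∈ Set.range x)
  have h2 : (Finset.univ.filter fun i => ¬ m i ∈ Set.range x).card ≤
      (Finset.univ.image x)ᶜ.card := by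
    refine Finset.card_le_card_of_injOn m ?_ hm.injOn
    intro i hi
    simpa using hi
  rw [Finset.card_compl, Finset.card_image_of_injective _ hx] at h2
  simp only [Finset.card_univ, Fintype.card_fin] at h1 h2
  omega

theorem stmt15 (N : Fin 8 → Finset (Fin 8))
    (hA : ∀ x, 4 ≤ (N x).card)
    (hB : ∀ y : Fin 8, 4 ≤ (Finset.univ.filter (fun x => y ∈ N x)).card)
    -- a 10-cycle `C` with `A`-vertices `x 0, …, x 4` and `B`-vertices
    -- `y 0, …, y 4`, whose edges are `(x i, y i)` and `(x (i+1), y i)`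
    (x y : Fin 5 → Fin 8)
    (hx : Function.Injective x) (hy : Function.Injective y)
    (hC1 : ∀ i, y i ∈ N (x i)) (hC2 : ∀ i, y i ∈ N (x (i + 1)))
    -- a matching `M` of size 5
    (M : Fin 5 → Fin 8 × Fin 8)
    (hMe : ∀ i, (M i).2 ∈ N (M i).1)
    (hMm : ∀ i j, i ≠ j → (M i).1 ≠ (M j).1 ∧ (M i).2 ≠ (M j).2) :
    ∃ J : Finset (Fin 8 × Fin 8),
      (∀ p ∈ J, p.2 ∈ N p.1) ∧
      -- J contains a 2P₃ from C
      (∃ e₁ e₂ e₃ e₄ : Fin 8 × Fin 8,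
        e₁ ∈ J ∧ e₂ ∈ J ∧ e₃ ∈ J ∧ e₄ ∈ J ∧
        (∃ i : Fin 5, e₁ = (x i, y i) ∨ e₁ = (x (i + 1), y i)) ∧
        (∃ i : Fin 5, e₂ = (x i, y i) ∨ e₂ = (x (i + 1), y i)) ∧
        (∃ i : Fin 5, e₃ = (x i, y i) ∨ e₃ = (x (i + 1), y i)) ∧
        (∃ i : Fin 5, e₄ = (x i, y i) ∨ e₄ = (x (i + 1), y i)) ∧
        IsP3 e₁ e₂ ∧ IsP3 e₃ e₄ ∧
        VDisj e₁ e₃ ∧ VDisj e₁ e₄ ∧ VDisj e₂ e₃ ∧ VDisj e₂ e₄) ∧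
      -- J contains a 2K₂ from M
      (∃ i j : Fin 5, i ≠ j ∧ M i ∈ J ∧ M j ∈ J) ∧
      -- H − E(J) has a perfect matching
      (∃ f : Fin 8 ≃ Fin 8, ∀ z, f z ∈ N z ∧ (z, f z) ∉ J) := by
  obtain ⟨i, j, hij, h⟩ : ∃ i j : Fin 5, i ≠ j ∧ Removable N x y (M i) (M j) := by
    classical
    have hP := two_le_card_filter_mem_range hx (m := fun i => (M i).1)
      fun i j h => by_contra fun hij => (hMm i j hij).1 h
    have hQ := two_le_card_filter_mem_range hy (m := fun i => (M i).2)
      fun i j h => by_contra fun hij => (hMm i j hij).2 h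
    set P := Finset.univ.filter fun i => (M i).1 ∈ Set.range x with hPdef
    set Q := Finset.univ.filter fun i => (M i).2 ∈ Set.range y with hQdef
    have memP : ∀ i, i ∈ P ↔ ∃ a, x a = (M i).1 := by simp [hPdef]
    have memQ : ∀ i, i ∈ Q ↔ ∃ a, y a = (M i).2 := by simp [hQdef]
    rcases lt_or_ge 1 (P ∩ Q).card with hPQ | hPQ
    · obtain ⟨i, hi, j, hj, hij⟩ := Finset.one_lt_card.1 hPQ
      rw [Finset.mem_inter, memP, memQ] at hi hj
      obtain ⟨⟨a, ha⟩, b, hb⟩ := hi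
      obtain ⟨⟨c, hc⟩, d, hd⟩ := hj
      have hne := hMm i j hij
      have hi := hMe i
      have hj := hMe j
      refine ⟨i, j, hij, ?_⟩
      rw [← Prod.mk.eta (p := M i), ← Prod.mk.eta (p := M j)]
      rw [← ha, ← hb] at hi hne ⊢
      rw [← hc, ← hd] at hj hne ⊢
      exact removable_inside hA hB hx hy hC1 hC2 hi hj (ne_of_apply_ne x hne.1)
        (ne_of_apply_ne y hne.2)
    · obtain ⟨e, heP, heQ⟩ : ∃ e ∈ P, e ∉ Q := by
        by_contra! hsub
        rw [Finset.inter_eq_left.2 hsub] at hPQ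
        omega
      obtain ⟨f, hfQ, hfP⟩ : ∃ f ∈ Q, f ∉ P := by
        by_contra! hsub
        rw [Finset.inter_eq_right.2 hsub] at hPQ
        omega
      obtain ⟨g, hgQ, hgf⟩ := Finset.exists_mem_ne (by omega : 1 < Q.card) f
      obtain ⟨a, ha⟩ := (memP e).1 heP
      obtain ⟨b, hb⟩ := (memQ f).1 hfQ
      obtain ⟨d, hd⟩ := (memQ g).1 hgQ
      rw [memQ] at heQ
      rw [memP] at hfP
      have he := hMe e
      have hf := hMe f
      have hg := hMe g
      have hgfne := hMm g f hgf
      have hef : e ≠ f := fun h => hfP ⟨a, by rw [ha, h]⟩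
      have heg : e ≠ g := fun h => heQ ⟨d, by rw [hd, h]⟩
      have hegne := hMm e g heg
      have hdb : d ≠ b := fun h => hgfne.2 (by rw [← hd, ← hb, h])
      by_cases hab : b - a = 2
      · by_cases hgP : g ∈ P
        · obtain ⟨c, hc⟩ := (memP g).1 hgP
          have hca : c ≠ a := fun h => hegne.1 (by rw [← hc, ← ha, h])
          by_cases hbad : (c - a, d - a) = (2, 1) ∨ (c - a, d - a) = (3, 3)
          · have hnot : (c - b, d - b) ≠ (2, 2) ∧ (c - b, d - b) ≠ (4, 3) := by
              clear * - hab hbad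
              revert a b c d
              decide
            refine ⟨f, g, hgf.symm, ?_⟩
            rw [← Prod.mk.eta (p := M f), ← Prod.mk.eta (p := M g), ← hb, ← hc, ← hd]
            rw [← hb] at hf
            rw [← hc, ← hd] at hg
            exact removable_right hA hB hx hy hC1 hC2 hfP hf hg hdb hnot.1 hnot.2
          · rw [not_or] at hbad
            refine ⟨e, g, heg, ?_⟩
            rw [← Prod.mk.eta (p := M e), ← Prod.mk.eta (p := M g), ← ha, ← hc, ← hd]
            rw [← ha] at he
            rw [← hc, ← hd] at hg
            exact removable_left hA hB hx hy hC1 hC2 heQ he hg hca hbad.1 hbad.2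
        · refine ⟨e, g, heg, ?_⟩
          rw [memP] at hgP
          rw [← Prod.mk.eta (p := M e), ← Prod.mk.eta (p := M g), ← ha, ← hd]
          rw [← ha] at he
          rw [← hd] at hg
          exact removable_left_right hA hB hx hy hC1 hC2 hgP heQ he hg
            fun h => hdb (sub_left_injective (h.trans hab.symm))
      · refine ⟨e, f, hef, ?_⟩
        rw [← Prod.mk.eta (p := M e), ← Prod.mk.eta (p := M f), ← ha, ← hb]
        rw [← ha] at he
        rw [← hb] at hf
        exact removable_left_right hA hB hx hy hC1 hC2 hfP heQ he hf hab
  obtain ⟨J, hJ, hpaths, hp, hq, hmatch⟩ := h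
  exact ⟨J, hJ, hpaths, ⟨i, j, hij, hp, hq⟩, hmatch⟩
end

section
/- Let H be a bipartite graph with parts A, B of size 8 and minimum degree at least 4. Suppose H contains a subgraph C that is a vertex-disjoint union of a 6-cycle and a 4-cycle, and a matching M of size 5. Then there exists a subgraph J of H containing two vertex-disjoint paths on 3 vertices from C and two disjoint edges from M, such that H − E(J) has a perfect matching. -/
/-- A bipartite relation on `Fin 8` has a perfect matching avoiding the edges in `L`. -/
def HasPM (R L : Fin 8 → Fin 8 → Prop) : Prop :=
  ∃ f : Fin 8 ≃ Fin 8, ∀ z, R z (f z) ∧ ¬ L z (f z)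

open Classical in
/-- Every vertex on the left has at least four neighbours. -/
def DegFour (R : Fin 8 → Fin 8 → Prop) : Prop :=
  ∀ a, 4 ≤ (Finset.univ.filter (R a)).card

/-- `L` has at most one row with three entries and at most one further row with two. -/
def RowBound (L : Fin 8 → Fin 8 → Prop) : Prop :=
  ∃ p q b₁ b₂ b₃ c₁ c₂, (∀ b, L p b → b = b₁ ∨ b = b₂ ∨ b = b₃) ∧
    (∀ b, L q b → b = c₁ ∨ b = c₂) ∧
    ∀ a b b', a ≠ p → a ≠ q → L a b → L a b' → b = b'

/-- All edges of `R` between `S` and `T` lie in `L`. -/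
def Within (R L : Fin 8 → Fin 8 → Prop)
    (S T : Finset (Fin 8)) : Prop :=
  ∀ a ∈ S, ∀ b ∈ T, R a b → L a b

theorem Within.flip {R L : Fin 8 → Fin 8 → Prop}
    {S T : Finset (Fin 8)} (h : Within R L S T) :
    Within (fun b a => R a b) (fun b a => L a b) T S := by
  intro b hb a ha hR
  exact h a ha b hb hR

theorem exists_within_of_not_hasPM {R L : Fin 8 → Fin 8 → Prop}
    (h : ¬ HasPM R L) : ∃ S T, S.card + T.card = 9 ∧ Within R L S T := by
  classical
  by_contra hc
  apply h
  have hall : ∀ S : Finset (Fin 8), S.card ≤ (S.biUnion fun a =>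
      Finset.univ.filter fun b => R a b ∧ ¬ L a b).card := by
    intro S
    by_contra! hlt
    set U := S.biUnion fun a => Finset.univ.filter fun b => R a b ∧ ¬ L a b with hU
    have hUc : (Uᶜ).card = 8 - U.card := by simp [Finset.card_compl]
    have hS : S.card ≤ 8 := by simpa using Finset.card_le_univ S
    obtain ⟨T, hT, hTc⟩ := Finset.exists_subset_card_eq (s := Uᶜ) (n := 9 - S.card) (by omega)
    refine hc ⟨S, T, by omega, fun a ha b hb hR => ?_⟩
    by_contra hab
    have hbU : b ∉ U := by simpa using hT hb
    exact hbU (by simp only [hU, Finset.mem_biUnion]; exact ⟨a, ha, by simp [hR, hab]⟩)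
  obtain ⟨f, hf, hfm⟩ := (Finset.all_card_le_biUnion_card_iff_exists_injective _).1 hall
  exact ⟨Equiv.ofBijective f (Finite.injective_iff_bijective.1 hf),
    fun z => by simpa using hfm z⟩

open Classical in
theorem Within.card_le {R L : Fin 8 → Fin 8 → Prop}
    {S T : Finset (Fin 8)} (hd : DegFour R) (h : Within R L S T) {a : Fin 8} (ha : a ∈ S) :
    T.card ≤ 4 + (T.filter fun b => R a b ∧ L a b).card := by
  have h1 : Finset.univ.filter (R a) ⊆ Tᶜ ∪ T.filter fun b => R a b ∧ L a b := by
    intro b hb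
    have hb' : R a b := by simpa using hb
    by_cases hT : b ∈ T
    · simp [hT, hb', h a ha b hT hb']
    · simp [hT]
  have h2 := (Finset.card_le_card h1).trans (Finset.card_union_le _ _)
  have h3 := hd a
  have h4 : T.card + (Tᶜ).card = 8 := by simp [Finset.card_add_card_compl]
  omega

theorem Within.four_le {R L : Fin 8 → Fin 8 → Prop}
    {S T : Finset (Fin 8)} (hd : DegFour R) (h : Within R L S T) (hL : RowBound L)
    (hc : S.card + T.card = 9) : 4 ≤ S.card := by
  classical
  obtain ⟨p, q, b₁, b₂, b₃, c₁, c₂, hp, hq, hr⟩ := hL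
  have hT : T.card ≤ 8 := by simpa using Finset.card_le_univ T
  have p3 : p ∈ S → T.card ≤ 7 := fun hpS => by
    have h1 := h.card_le hd hpS
    have h2 : (T.filter fun b => R p b ∧ L p b) ⊆ {b₁, b₂, b₃} := by
      intro b hb; simpa using hp b (by simp at hb; exact hb.2.2)
    have := (Finset.card_le_card h2).trans Finset.card_le_three
    omega
  have q2 : q ∈ S → T.card ≤ 6 := fun hqS => by
    have h1 := h.card_le hd hqS
    have h2 : (T.filter fun b => R q b ∧ L q b) ⊆ {c₁, c₂} := by
      intro b hb; simpa using hq b (by simp at hb; exact hb.2.2)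
    have := (Finset.card_le_card h2).trans Finset.card_le_two
    omega
  have r1 : ∀ a ∈ S, a ≠ p → a ≠ q → T.card ≤ 5 := fun a ha hap haq => by
    have h1 := h.card_le hd ha
    have : (T.filter fun b => R a b ∧ L a b).card ≤ 1 := by
      rw [Finset.card_le_one]
      intro b hb b' hb'
      simp at hb hb'
      exact hr a b b' hap haq hb.2.2 hb'.2.2
    omega
  by_contra! hlt
  by_cases h6 : T.card ≤ 6
  · obtain ⟨a, ha, hn⟩ := Finset.exists_mem_notMem_of_card_lt_card
      (s := {p, q}) (t := S) (Finset.card_le_two.trans_lt (by omega))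
    simp only [Finset.mem_insert, Finset.mem_singleton, not_or] at hn
    have := r1 a ha hn.1 hn.2
    omega
  · have hqS : q ∉ S := fun hqS => h6 (q2 hqS)
    have hS : S ⊆ {p} := by
      intro a ha
      by_contra hap
      have := r1 a ha (by simpa using hap) (fun e => hqS (e ▸ ha))
      omega
    have h1 := Finset.card_le_card hS
    obtain ⟨a, ha⟩ := Finset.card_pos.1 (show 0 < S.card by omega)
    have : a = p := by simpa using hS ha
    have := p3 (this ▸ ha)
    simp at h1
    omega

/-- A set `S` of four vertices each sending an edge, necessarily in `L`, to `T`, `|T| = 5`. -/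
structure Obstr (R L : Fin 8 → Fin 8 → Prop)
    (S T : Finset (Fin 8)) : Prop where
  within : Within R L S T
  cardS : S.card = 4
  cardT : T.card = 5

theorem obstr_of_not_hasPM {R L : Fin 8 → Fin 8 → Prop}
    (hd : DegFour R) (hd' : DegFour (fun b a => R a b)) (h : ¬ HasPM R L) (hr : RowBound L)
    (hc : RowBound (fun b a => L a b)) :
    (∃ S T, Obstr R L S T) ∨ ∃ S T, Obstr (fun b a => R a b) (fun b a => L a b) S T := by
  obtain ⟨S, T, hST, hW⟩ := exists_within_of_not_hasPM h
  have h1 := hW.four_le hd hr hST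
  have h2 := hW.flip.four_le hd' hc (by omega)
  rcases (show S.card = 4 ∨ T.card = 4 by omega) with h4 | h4
  · exact .inl ⟨S, T, hW, h4, by omega⟩
  · exact .inr ⟨T, S, hW.flip, h4, by omega⟩

theorem Obstr.exists_mem {R L : Fin 8 → Fin 8 → Prop}
    {S T : Finset (Fin 8)} (hd : DegFour R) (h : Obstr R L S T) :
    ∀ a ∈ S, ∃ b ∈ T, R a b ∧ L a b := by
  classical
  intro a ha
  have := h.within.card_le hd ha
  rw [h.cardT] at this
  obtain ⟨b, hb⟩ := Finset.card_pos.1 (show 0 < (T.filter fun b => R a b ∧ L a b).card by omega)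
  exact ⟨b, by simpa using hb⟩

/-- A vertex of `S` with a single `L`-edge is joined to everything outside `T`. -/
theorem Obstr.adj {R L : Fin 8 → Fin 8 → Prop}
    {S T : Finset (Fin 8)} (hd : DegFour R) (h : Obstr R L S T) {a c : Fin 8} (ha : a ∈ S)
    (hc : ∀ b, L a b → b = c) : c ∈ T ∧ ∀ b, R a b ↔ b ∉ T ∨ b = c := by
  classical
  obtain ⟨b, hb, hR, hL⟩ := h.exists_mem hd a ha
  obtain rfl := hc b hL
  refine ⟨hb, fun z => ⟨fun hz => ?_, ?_⟩⟩
  · by_cases hzT : z ∈ T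
    · exact .inr (hc z (h.within a ha z hzT hz))
    · exact .inl hzT
  · rintro (hz | rfl)
    · by_contra hzR
      have hsub : Finset.univ.filter (R a) ⊆ insert b (Tᶜ.erase z) := by
        intro d hd
        have hd' : R a d := by simpa using hd
        by_cases hdT : d ∈ T
        · simp [hc d (h.within a ha d hdT hd')]
        · have : d ≠ z := by rintro rfl; exact hzR hd'
          simp [hdT, this]
      have h1 := (Finset.card_le_card hsub).trans (Finset.card_insert_le _ _)
      have h2 : (Tᶜ.erase z).card = 2 := by
        rw [Finset.card_erase_of_mem (by simpa using hz), Finset.card_compl, h.cardT]; rfl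
      have := hd a
      omega
    · exact hR

theorem Obstr.exists_ne {R L : Fin 8 → Fin 8 → Prop}
    {S T : Finset (Fin 8)} (h : Obstr R L S T) (a b c : Fin 8) :
    ∃ s ∈ S, s ≠ a ∧ s ≠ b ∧ s ≠ c := by
  obtain ⟨s, hs, hn⟩ := Finset.exists_mem_notMem_of_card_lt_card
    (s := {a, b, c}) (t := S) (Finset.card_le_three.trans_lt (by rw [h.cardS]; norm_num))
  exact ⟨s, hs, by simpa using hn⟩

/-- Four vertices outside the five-element set `T` cannot be distinct. -/
theorem Obstr.compl {R L : Fin 8 → Fin 8 → Prop}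
    {S T : Finset (Fin 8)} (h : Obstr R L S T) {a b c d : Fin 8}
    (ha : a ∉ T) (hb : b ∉ T) (hc : c ∉ T) (hd : d ∉ T) (hab : a ≠ b) (hac : a ≠ c)
    (had : a ≠ d) (hbc : b ≠ c) (hbd : b ≠ d) (hcd : c ≠ d) : False := by
  have hsub : {a, b, c, d} ⊆ Tᶜ := by
    intro z hz
    simp only [Finset.mem_insert, Finset.mem_singleton] at hz
    rcases hz with rfl | rfl | rfl | rfl <;> simpa
  have h1 := Finset.card_le_card hsub
  rw [Finset.card_compl, h.cardT, Finset.card_insert_of_notMem (by simp [*]),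
    Finset.card_insert_of_notMem (by simp [*]), Finset.card_pair hcd] at h1
  simp at h1

/-- The set of edges of `C` contains a `2P₃` and `Mt` contains two edges whose removal
leaves a perfect matching in `R`. -/
def IsGood (R C Mt : Fin 8 → Fin 8 → Prop) : Prop :=
  ∃ e₁ e₂ e₃ e₄ m₁ m₂ : Fin 8 × Fin 8,
    (C e₁.1 e₁.2 ∧ C e₂.1 e₂.2 ∧ C e₃.1 e₃.2 ∧ C e₄.1 e₄.2) ∧
    (IsP3 e₁ e₂ ∧ IsP3 e₃ e₄ ∧ VDisj e₁ e₃ ∧ VDisj e₁ e₄ ∧ VDisj e₂ e₃ ∧ VDisj e₂ e₄) ∧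
    (m₁ ≠ m₂ ∧ Mt m₁.1 m₁.2 ∧ Mt m₂.1 m₂.2) ∧ HasPM R fun a b =>
      (a = e₁.1 ∧ b = e₁.2) ∨ (a = e₂.1 ∧ b = e₂.2) ∨ (a = e₃.1 ∧ b = e₃.2) ∨
      (a = e₄.1 ∧ b = e₄.2) ∨ (a = m₁.1 ∧ b = m₁.2) ∨ (a = m₂.1 ∧ b = m₂.2)

theorem HasPM.flip {R L : Fin 8 → Fin 8 → Prop} (h : HasPM R L) :
    HasPM (fun b a => R a b) (fun b a => L a b) := by
  obtain ⟨f, hf⟩ := h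
  refine ⟨f.symm, fun z => ?_⟩
  have := hf (f.symm z)
  rwa [Equiv.apply_symm_apply] at this

theorem IsGood.flip {R C Mt : Fin 8 → Fin 8 → Prop} (h : IsGood R C Mt) :
    IsGood (fun b a => R a b) (fun b a => C a b) (fun b a => Mt a b) := by
  obtain ⟨e₁, e₂, e₃, e₄, m₁, m₂, hC, hV, hM, hP⟩ := h
  refine ⟨e₁.swap, e₂.swap, e₃.swap, e₄.swap, m₁.swap, m₂.swap, hC, ?_, by simpa using hM, ?_⟩
  · simp only [IsP3, VDisj, Prod.fst_swap, Prod.snd_swap] at hV ⊢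
    grind
  · simpa only [Prod.fst_swap, Prod.snd_swap, and_comm] using hP.flip

/-- An edge of `Mt` inside one path, a second one at its other leaf. -/
theorem isGood_of_edge_mem {R C Mt : Fin 8 → Fin 8 → Prop} (hR : DegFour R)
    (hR' : DegFour (fun b a => R a b)) (hCR : ∀ a b, C a b → R a b)
    {p q₀ q₁ a c c' d d₁ d₂ : Fin 8} (h₁ : C p q₀) (h₂ : C p q₁) (h₃ : C c d) (h₄ : C c d₁)
    (h₅ : C c' d) (h₆ : C c' d₂) (m₁ : Mt p q₀) (m₂ : Mt a q₁) (hap : a ≠ p) (hq : q₀ ≠ q₁)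
    (hcp : c ≠ p) (hcp' : c' ≠ p) (hcc : c ≠ c') (hd₁ : d ≠ d₁) (hd₂ : d ≠ d₂)
    (hd : d ≠ q₀ ∧ d ≠ q₁) (hd₁' : d₁ ≠ q₀ ∧ d₁ ≠ q₁) (hd₂' : d₂ ≠ q₀ ∧ d₂ ≠ q₁) :
    IsGood R C Mt := by
  by_contra hG
  have key : ∀ c c' d₁, C c d → C c d₁ → C c' d → c ≠ p → c' ≠ p → c ≠ c' → d ≠ d₁ →
      d₁ ≠ q₀ → d₁ ≠ q₁ → ∃ S : Finset (Fin 8), c ∈ S ∧ c' ∉ S ∧ p ∈ S ∧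
      (∀ z, R z d ↔ z ∉ S ∨ z = c) ∧ ∀ z, R z q₀ ↔ z ∉ S ∨ z = p := by
    intro c c' d₁ h₃ h₄ h₅ hcp hcp' hcc hd₁ hd₂ hd₃
    have n : ¬ HasPM R fun s t => (s = p ∧ t = q₀) ∨ (s = p ∧ t = q₁) ∨ (s = c ∧ t = d) ∨
        (s = c ∧ t = d₁) ∨ (s = p ∧ t = q₀) ∨ (s = a ∧ t = q₁) := by
      intro h
      refine hG ⟨(_, _), (_, _), (_, _), (_, _), (_, _), (_, _),
        ⟨h₁, h₂, h₃, h₄⟩, ?_, ⟨?_, m₁, m₂⟩, h⟩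
      · simp only [IsP3, VDisj]; grind
      · grind
    rcases obstr_of_not_hasPM hR hR' n
      ⟨c, p, d, d₁, q₁, q₀, q₁, by grind (splits := 20), by grind (splits := 20),
        by grind (splits := 20)⟩
      ⟨q₁, q₁, p, a, a, p, a, by grind (splits := 20), by grind (splits := 20),
        by grind (splits := 20)⟩ with
      ⟨S, T, h⟩ | ⟨T, S, h⟩
    · obtain ⟨s, hs, hn⟩ := h.exists_ne p c a
      have := h.exists_mem hR s hs
      grind
    · have hT : ∀ t ∈ T, t = q₀ ∨ t = q₁ ∨ t = d ∨ t = d₁ := by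
        intro t ht
        have := h.exists_mem hR' t ht
        grind
      have e₁ : q₀ ∈ T := by have := h.exists_ne q₁ d d₁; grind
      have e₂ : d ∈ T := by have := h.exists_ne q₁ q₀ d₁; grind
      have f₁ := h.adj hR' (c := p) e₁ (by grind)
      have f₂ := h.adj hR' (c := c) e₂ (by grind)
      have := hCR _ _ h₅
      refine ⟨S, f₂.1, ?_, f₁.1, f₂.2, f₁.2⟩
      have := (f₂.2 c').1 this
      grind
  obtain ⟨S, k⟩ := key c c' d₁ h₃ h₄ h₅ hcp hcp' hcc hd₁ hd₁'.1 hd₁'.2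
  obtain ⟨S', k'⟩ := key c' c d₂ h₅ h₆ h₃ hcp' hcp hcc.symm hd₂ hd₂'.1 hd₂'.2
  have := k.2.2.2.2 c'
  have := k'.2.2.2.2 c'
  grind

theorem isGood_of_edge_mem_of_opposite {R C Mt : Fin 8 → Fin 8 → Prop} (hR : DegFour R)
    (hR' : DegFour (fun b a => R a b)) (hCR : ∀ a b, C a b → R a b)
    {x₀ x₁ x₂ y₀ y₁ y₂ b : Fin 8} (h₁ : C x₀ y₀) (h₂ : C x₀ y₂) (h₃ : C x₁ y₁) (h₄ : C x₂ y₁)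
    (h₅ : C x₂ y₂) (m₁ : Mt x₀ y₀) (m₂ : Mt x₂ b) (hx : x₀ ≠ x₁ ∧ x₀ ≠ x₂ ∧ x₁ ≠ x₂)
    (hy : y₀ ≠ y₁ ∧ y₀ ≠ y₂ ∧ y₁ ≠ y₂) (hb : b ≠ y₀) : IsGood R C Mt := by
  by_contra hG
  have n : ¬ HasPM R fun s t => (s = x₀ ∧ t = y₀) ∨ (s = x₀ ∧ t = y₂) ∨ (s = x₁ ∧ t = y₁) ∨
      (s = x₂ ∧ t = y₁) ∨ (s = x₀ ∧ t = y₀) ∨ (s = x₂ ∧ t = b) := by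
    intro h
    refine hG ⟨(_, _), (_, _), (_, _), (_, _), (_, _), (_, _),
        ⟨h₁, h₂, h₃, h₄⟩, ?_, ⟨?_, m₁, m₂⟩, h⟩
    · simp only [IsP3, VDisj]; grind
    · grind
  rcases obstr_of_not_hasPM hR hR' n
    ⟨x₀, x₂, y₀, y₂, y₂, y₁, b, by grind (splits := 20), by grind (splits := 20),
        by grind (splits := 20)⟩
    ⟨b, y₁, x₀, x₁, x₂, x₁, x₂, by grind (splits := 20), by grind (splits := 20),
        by grind (splits := 20)⟩ with
    ⟨S, T, h⟩ | ⟨T, S, h⟩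
  · obtain ⟨s, hs, hn⟩ := h.exists_ne x₀ x₁ x₂
    have := h.exists_mem hR s hs
    grind
  · have hT : ∀ t ∈ T, t = y₀ ∨ t = y₁ ∨ t = y₂ ∨ t = b := by
      intro t ht
      have := h.exists_mem hR' t ht
      grind
    have e₁ : y₂ ∈ T := by have := h.exists_ne y₀ y₁ b; grind
    have e₂ : b ∈ T := by have := h.exists_ne y₀ y₁ y₂; grind
    have e₃ : b ≠ y₂ := by have := h.exists_ne y₀ y₁ y₂; grind
    have e₄ : b ≠ y₁ := by have := h.exists_ne y₀ y₁ y₂; grind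
    have f₁ := h.adj hR' (c := x₀) e₁ (by grind)
    have f₂ := h.adj hR' (c := x₂) e₂ (by grind)
    have := (f₁.2 x₂).1 (hCR _ _ h₅)
    grind

/-- Two crossing edges of `Mt`, joining the two cycles, whose ends are adjacent in the 6-cycle. -/
theorem isGood_of_crossing_adjacent {R C Mt : Fin 8 → Fin 8 → Prop} (hR : DegFour R)
    (hR' : DegFour (fun b a => R a b)) {p q₀ q₁ w u u' : Fin 8}
    (h₁ : C p q₀) (h₂ : C p q₁) (h₃ : C u w) (h₄ : C u' w) (m₁ : Mt p w) (m₂ : Mt u q₀)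
    (hq : q₀ ≠ q₁ ∧ w ≠ q₀ ∧ w ≠ q₁) (hp : u ≠ u' ∧ u ≠ p ∧ u' ≠ p) : IsGood R C Mt := by
  by_contra hG
  have n : ¬ HasPM R fun s t => (s = p ∧ t = q₀) ∨ (s = p ∧ t = q₁) ∨ (s = u ∧ t = w) ∨
      (s = u' ∧ t = w) ∨ (s = p ∧ t = w) ∨ (s = u ∧ t = q₀) := by
    intro h
    refine hG ⟨(_, _), (_, _), (_, _), (_, _), (_, _), (_, _), ⟨h₁, h₂, h₃, h₄⟩, ?_,
      ⟨?_, m₁, m₂⟩, h⟩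
    · simp only [IsP3, VDisj]; grind
    · grind
  rcases obstr_of_not_hasPM hR hR' n
    ⟨p, u, q₀, q₁, w, w, q₀, by grind (splits := 20), by grind (splits := 20),
      by grind (splits := 20)⟩
    ⟨w, q₀, u, u', p, p, u, by grind (splits := 20), by grind (splits := 20),
      by grind (splits := 20)⟩ with
    ⟨S, T, h⟩ | ⟨T, S, h⟩
  · obtain ⟨s, hs, hn⟩ := h.exists_ne p u u'
    have := h.exists_mem hR s hs
    grind
  · obtain ⟨s, hs, hn⟩ := h.exists_ne q₀ q₁ w
    have := h.exists_mem hR' s hs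
    grind

/-- Two crossing edges of `Mt`, joining the two cycles, whose ends are opposite in the 6-cycle. -/
theorem isGood_of_crossing_opposite {R C Mt : Fin 8 → Fin 8 → Prop} (hR : DegFour R)
    (hR' : DegFour (fun b a => R a b)) (hCR : ∀ a b, C a b → R a b)
    {x₀ x₁ x₂ y₀ y₁ y₂ u u' w w' : Fin 8} (h₁ : C x₀ y₀) (h₂ : C x₀ y₂) (h₃ : C x₁ y₁)
    (h₄ : C x₂ y₁) (h₅ : C x₁ y₀) (h₆ : C x₂ y₂) (k₁ : C u w) (k₂ : C u w') (k₃ : C u' w)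
    (m₁ : Mt x₀ w) (m₂ : Mt u y₁)
    (hx : x₀ ≠ x₁ ∧ x₀ ≠ x₂ ∧ x₁ ≠ x₂) (hy : y₀ ≠ y₁ ∧ y₀ ≠ y₂ ∧ y₁ ≠ y₂)
    (hu : u ≠ u' ∧ u ≠ x₀ ∧ u ≠ x₁ ∧ u ≠ x₂ ∧ u' ≠ x₀ ∧ u' ≠ x₁ ∧ u' ≠ x₂)
    (hw : w ≠ w' ∧ w ≠ y₀ ∧ w ≠ y₁ ∧ w ≠ y₂ ∧ w' ≠ y₀ ∧ w' ≠ y₁ ∧ w' ≠ y₂) :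
    IsGood R C Mt := by
  by_contra hG
  have n : ¬ HasPM R fun s t => (s = x₀ ∧ t = y₀) ∨ (s = x₀ ∧ t = y₂) ∨ (s = x₁ ∧ t = y₁) ∨
      (s = x₂ ∧ t = y₁) ∨ (s = x₀ ∧ t = w) ∨ (s = u ∧ t = y₁) := by
    intro h
    refine hG ⟨(_, _), (_, _), (_, _), (_, _), (_, _), (_, _), ⟨h₁, h₂, h₃, h₄⟩, ?_,
      ⟨?_, m₁, m₂⟩, h⟩
    · simp only [IsP3, VDisj]; grind
    · grind
  rcases obstr_of_not_hasPM hR hR' n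
    ⟨x₀, x₁, y₀, y₂, w, y₁, y₁, by grind (splits := 20), by grind (splits := 20),
      by grind (splits := 20)⟩
    ⟨y₁, y₀, x₁, x₂, u, x₀, x₀, by grind (splits := 20), by grind (splits := 20),
      by grind (splits := 20)⟩ with
    ⟨S, T, h⟩ | ⟨T, S, h⟩
  · have hS : ∀ s ∈ S, s = x₀ ∨ s = x₁ ∨ s = x₂ ∨ s = u := by
      intro s hs
      have := h.exists_mem hR s hs
      grind
    have e₁ : x₁ ∈ S := by have := h.exists_ne x₀ x₂ u; grind
    have e₂ : x₂ ∈ S := by have := h.exists_ne x₀ x₁ u; grind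
    have e₃ : u ∈ S := by have := h.exists_ne x₀ x₁ x₂; grind
    have f₁ := (h.adj hR (c := y₁) e₁ (by grind)).2 y₀
    have f₂ := (h.adj hR (c := y₁) e₂ (by grind)).2 y₂
    have f₃ := (h.adj hR (c := y₁) e₃ (by grind)).2
    have g₁ := f₃ w
    have g₂ := f₃ w'
    exact h.compl (a := y₀) (b := y₂) (c := w) (d := w') (by grind) (by grind) (by grind)
      (by grind) (by grind) (by grind) (by grind) (by grind) (by grind) (by grind)
  · have hT : ∀ t ∈ T, t = y₁ ∨ t = y₀ ∨ t = y₂ ∨ t = w := by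
      intro s hs
      have := h.exists_mem hR' s hs
      grind
    have e₁ : y₀ ∈ T := by have := h.exists_ne y₁ y₂ w; grind
    have e₂ : y₂ ∈ T := by have := h.exists_ne y₁ y₀ w; grind
    have e₃ : w ∈ T := by have := h.exists_ne y₁ y₀ y₂; grind
    have f₁ := (h.adj hR' (c := x₀) e₁ (by grind)).2 x₁
    have f₂ := (h.adj hR' (c := x₀) e₂ (by grind)).2 x₂
    have f₃ := (h.adj hR' (c := x₀) e₃ (by grind)).2
    have g₁ := f₃ u
    have g₂ := f₃ u'
    exact h.compl (a := x₁) (b := x₂) (c := u) (d := u') (by grind) (by grind) (by grind)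
      (by grind) (by grind) (by grind) (by grind) (by grind) (by grind) (by grind)

/-- An edge of `Mt` at the centre of a path and one at its leaf `q₀`, together with a second path
`d₀ c d₁`: if this is not good, there is an obstruction on the right-hand side. -/
theorem exists_obstr_of_center_leaf {R C Mt : Fin 8 → Fin 8 → Prop} (hR : DegFour R)
    (hR' : DegFour (fun b a => R a b)) {p q₀ q₁ a b c d₀ d₁ : Fin 8}
    (hG : ¬ IsGood R C Mt) (h₁ : C p q₀) (h₂ : C p q₁) (h₃ : C c d₀) (h₄ : C c d₁)
    (m₁ : Mt p b) (m₂ : Mt a q₀) (hq : q₀ ≠ q₁) (hb : b ≠ q₀ ∧ b ≠ q₁) (hap : a ≠ p)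
    (hac : a ≠ c) (hcp : c ≠ p) (hd : d₀ ≠ d₁)
    (hd₀ : d₀ ≠ q₀ ∧ d₀ ≠ q₁ ∧ d₀ ≠ b) (hd₁ : d₁ ≠ q₀ ∧ d₁ ≠ q₁ ∧ d₁ ≠ b) :
    ∃ S T : Finset (Fin 8),
      (∀ e f g, ∃ t ∈ T, t ≠ e ∧ t ≠ f ∧ t ≠ g) ∧
      (∀ t ∈ T, t = q₀ ∨ t = q₁ ∨ t = b ∨ t = d₀ ∨ t = d₁) ∧
      (∀ t ∈ T, t = q₁ ∨ t = b → p ∈ S ∧ ∀ z, R z t ↔ z ∉ S ∨ z = p) ∧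
      (∀ t ∈ T, t = d₀ ∨ t = d₁ → c ∈ S ∧ ∀ z, R z t ↔ z ∉ S ∨ z = c) ∧
      (q₀ ∈ T → ∀ z, R z q₀ → z ∉ S ∨ z = p ∨ z = a) ∧ S.card = 5 := by
  have n : ¬ HasPM R fun s t => (s = p ∧ t = q₀) ∨ (s = p ∧ t = q₁) ∨ (s = c ∧ t = d₀) ∨
      (s = c ∧ t = d₁) ∨ (s = p ∧ t = b) ∨ (s = a ∧ t = q₀) := by
    intro h
    refine hG ⟨(_, _), (_, _), (_, _), (_, _), (_, _), (_, _), ⟨h₁, h₂, h₃, h₄⟩, ?_,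
      ⟨?_, m₁, m₂⟩, h⟩
    · simp only [IsP3, VDisj]; grind
    · grind
  rcases obstr_of_not_hasPM hR hR' n
    ⟨p, c, q₀, q₁, b, d₀, d₁, by grind (splits := 20), by grind (splits := 20),
      by grind (splits := 20)⟩
    ⟨q₀, q₀, p, a, a, p, a, by grind (splits := 20), by grind (splits := 20),
      by grind (splits := 20)⟩ with
    ⟨S, T, h⟩ | ⟨T, S, h⟩
  · obtain ⟨s, hs, hn⟩ := h.exists_ne p c a
    have := h.exists_mem hR s hs
    grind
  · refine ⟨S, T, h.exists_ne, fun t ht => ?_, fun t ht ht' => h.adj hR' ht ?_,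
      fun t ht ht' => h.adj hR' ht ?_, fun ht z hz => ?_, h.cardT⟩
    · have := h.exists_mem hR' t ht
      grind
    · grind (splits := 20)
    · grind (splits := 20)
    · have := h.within q₀ ht z
      grind (splits := 20)

theorem isGood_of_center_leaf_hexagon {R C Mt : Fin 8 → Fin 8 → Prop} (hR : DegFour R)
    (hR' : DegFour (fun b a => R a b)) (hCR : ∀ a b, C a b → R a b)
    {p q₀ q₁ a b x₀ x₁ x₂ y₀ y₁ y₂ : Fin 8}
    (h₁ : C p q₀) (h₂ : C p q₁) (m₁ : Mt p b) (m₂ : Mt a q₀)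
    (k₀ : C x₀ y₀) (k₁ : C x₁ y₁) (k₂ : C x₂ y₂) (l₀ : C x₁ y₀) (l₁ : C x₂ y₁) (l₂ : C x₀ y₂)
    (hx : x₀ ≠ x₁ ∧ x₀ ≠ x₂ ∧ x₁ ≠ x₂) (hy : y₀ ≠ y₁ ∧ y₀ ≠ y₂ ∧ y₁ ≠ y₂)
    (hq : q₀ ≠ q₁) (hb : b ≠ q₀ ∧ b ≠ q₁) (hap : a ≠ p)
    (ha : a ≠ x₀ ∧ a ≠ x₁ ∧ a ≠ x₂) (hp : p ≠ x₀ ∧ p ≠ x₁ ∧ p ≠ x₂)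
    (hy₀ : y₀ ≠ q₀ ∧ y₀ ≠ q₁ ∧ y₀ ≠ b) (hy₁ : y₁ ≠ q₀ ∧ y₁ ≠ q₁ ∧ y₁ ≠ b)
    (hy₂ : y₂ ≠ q₀ ∧ y₂ ≠ q₁ ∧ y₂ ≠ b) : IsGood R C Mt := by
  by_contra hG
  have key : ∀ c c₀ c₁ d₀ d₁, C c d₀ → C c d₁ → R c₀ d₀ → R c₁ d₁ → c ≠ p → a ≠ c → d₀ ≠ d₁ →
      c₀ ≠ c → c₁ ≠ c → d₀ ≠ q₀ ∧ d₀ ≠ q₁ ∧ d₀ ≠ b → d₁ ≠ q₀ ∧ d₁ ≠ q₁ ∧ d₁ ≠ b →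
      ∃ S : Finset (Fin 8), c ∈ S ∧ p ∈ S ∧ (c₀ ∉ S ∨ c₁ ∉ S) ∧
        ((∀ z, R z q₁ ↔ z ∉ S ∨ z = p) ∨ (∀ z, R z b ↔ z ∉ S ∨ z = p)) ∧
        (c₀ ∈ S ∨ c₁ ∈ S → (∀ z, R z q₁ ↔ z ∉ S ∨ z = p) ∧ ∀ z, R z b ↔ z ∉ S ∨ z = p) := by
    intro c c₀ c₁ d₀ d₁ e₁ e₂ e₃ e₄ n₁ n₂ n₃ n₄ n₅ n₆ n₇
    obtain ⟨S, T, f₁, f₂, f₃, f₄, f₅, -⟩ := exists_obstr_of_center_leaf hR hR' hG h₁ h₂ e₁ e₂ m₁ m₂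
      hq hb hap n₂ n₁ n₃ n₆ n₇
    have g₁ := f₁ q₀ d₀ d₁
    have g₂ := f₁ q₀ q₁ b
    have g₃ := f₁ q₀ q₁ d₀
    have g₄ := f₁ q₀ q₁ d₁
    have g₅ := f₁ q₀ b d₀
    have g₆ := f₁ q₀ b d₁
    have t₁ := f₃ q₁
    have t₂ := f₃ b
    have t₃ := f₄ d₀
    have t₄ := f₄ d₁
    have : q₁ ∈ T ∨ b ∈ T := by grind
    have : d₀ ∈ T ∨ d₁ ∈ T := by grind
    have v₁ : d₀ ∈ T → c ∈ S ∧ c₀ ∉ S := fun h => by have := (t₃ h (.inl rfl)).2 c₀; grind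
    have v₂ : d₁ ∈ T → c ∈ S ∧ c₁ ∉ S := fun h => by have := (t₄ h (.inr rfl)).2 c₁; grind
    have v₃ : d₀ ∉ T ∨ d₁ ∉ T → q₁ ∈ T ∧ b ∈ T := by grind
    refine ⟨S, by grind, by grind, by grind, ?_, fun h => ?_⟩
    · rcases ‹q₁ ∈ T ∨ b ∈ T› with h | h
      · exact .inl (t₁ h (.inl rfl)).2
      · exact .inr (t₂ h (.inr rfl)).2
    · have := v₃ (by grind)
      exact ⟨(t₁ this.1 (.inl rfl)).2, (t₂ this.2 (.inr rfl)).2⟩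
  obtain ⟨S₀, i₀⟩ := key x₀ x₁ x₂ y₀ y₂ k₀ l₂ (hCR _ _ l₀) (hCR _ _ k₂) (by grind) (by grind)
    (by grind) (by grind) (by grind) hy₀ hy₂
  obtain ⟨S₁, i₁⟩ := key x₁ x₂ x₀ y₁ y₀ k₁ l₀ (hCR _ _ l₁) (hCR _ _ k₀) (by grind) (by grind)
    (by grind) (by grind) (by grind) hy₁ hy₀
  obtain ⟨S₂, i₂⟩ := key x₂ x₀ x₁ y₂ y₁ k₂ l₁ (hCR _ _ l₂) (hCR _ _ k₁) (by grind) (by grind)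
    (by grind) (by grind) (by grind) hy₂ hy₁
  have inst : ∀ {S : Finset (Fin 8)} {t}, (∀ z, R z t ↔ z ∉ S ∨ z = p) →
      (R x₀ t ↔ x₀ ∉ S) ∧ (R x₁ t ↔ x₁ ∉ S) ∧ (R x₂ t ↔ x₂ ∉ S) := by
    intro S t h
    rw [h, h, h]
    grind
  obtain ⟨s₀, -, n₀, a₀, b₀⟩ := i₀
  obtain ⟨s₁, -, n₁, a₁, b₁⟩ := i₁
  obtain ⟨s₂, -, n₂, a₂, b₂⟩ := i₂
  have a₀' := a₀.imp inst inst
  have a₁' := a₁.imp inst inst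
  have a₂' := a₂.imp inst inst
  have b₀' := fun h => (b₀ h).imp inst inst
  have b₁' := fun h => (b₁ h).imp inst inst
  have b₂' := fun h => (b₂ h).imp inst inst
  clear a₀ a₁ a₂ b₀ b₁ b₂ inst key
  grind (splits := 40)

theorem isGood_of_center_leaf_square {R C Mt : Fin 8 → Fin 8 → Prop} (hR : DegFour R)
    (hR' : DegFour (fun b a => R a b)) (hCR : ∀ a b, C a b → R a b)
    {p q₀ q₁ a b u₀ u₁ w₀ w₁ : Fin 8}
    (h₁ : C p q₀) (h₂ : C p q₁) (m₁ : Mt p b) (m₂ : Mt a q₀)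
    (k₀ : C u₀ w₀) (k₁ : C u₁ w₁) (l₀ : C u₁ w₀) (l₁ : C u₀ w₁)
    (hu : u₀ ≠ u₁) (hw : w₀ ≠ w₁) (hq : q₀ ≠ q₁) (hb : b ≠ q₀ ∧ b ≠ q₁) (hap : a ≠ p)
    (ha : a ≠ u₀ ∧ a ≠ u₁) (hp : p ≠ u₀ ∧ p ≠ u₁)
    (hw₀ : w₀ ≠ q₀ ∧ w₀ ≠ q₁ ∧ w₀ ≠ b) (hw₁ : w₁ ≠ q₀ ∧ w₁ ≠ q₁ ∧ w₁ ≠ b) : IsGood R C Mt := by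
  classical
  by_contra hG
  obtain ⟨S₀, T₀, f₁, f₂, f₃, f₄, f₅, f₆⟩ := exists_obstr_of_center_leaf hR hR' hG h₁ h₂ k₀ l₁
    m₁ m₂ hq hb hap ha.1 hp.1.symm hw hw₀ hw₁
  obtain ⟨S₁, T₁, g₁, g₂, g₃, g₄, g₅, -⟩ := exists_obstr_of_center_leaf hR hR' hG h₁ h₂ l₀ k₁
    m₁ m₂ hq hb hap ha.2 hp.2.symm hw hw₀ hw₁
  have mem₀ : ∀ e f g, ∃ t ∈ T₀, (t = q₀ ∨ t = q₁ ∨ t = b ∨ t = w₀ ∨ t = w₁) ∧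
      t ≠ e ∧ t ≠ f ∧ t ≠ g := by
    intro e f g
    obtain ⟨t, ht, h⟩ := f₁ e f g
    exact ⟨t, ht, f₂ t ht, h⟩
  have mem₁ : ∀ e f g, ∃ t ∈ T₁, (t = q₀ ∨ t = q₁ ∨ t = b ∨ t = w₀ ∨ t = w₁) ∧
      t ≠ e ∧ t ≠ f ∧ t ≠ g := by
    intro e f g
    obtain ⟨t, ht, h⟩ := g₁ e f g
    exact ⟨t, ht, g₂ t ht, h⟩
  have i₀ : u₀ ∈ S₀ ∧ u₁ ∉ S₀ := by
    obtain ⟨t, ht, h, h'⟩ := mem₀ q₀ q₁ b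
    have := f₄ t ht (by grind)
    have := this.2 u₁
    grind
  have i₁ : u₁ ∈ S₁ ∧ u₀ ∉ S₁ := by
    obtain ⟨t, ht, h, h'⟩ := mem₁ q₀ q₁ b
    have := g₄ t ht (by grind)
    have := this.2 u₀
    grind
  have ne : ∀ t, t = q₁ ∨ t = b → ¬ (t ∈ T₀ ∧ t ∈ T₁) := by
    rintro t ht ⟨j₀, j₁⟩
    have := (f₃ t j₀ ht).2 u₀
    have := (g₃ t j₁ ht).2 u₀
    grind
  have ne₁ := ne q₁ (.inl rfl)
  have ne₂ := ne b (.inr rfl)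
  have v₀ := mem₀ q₀ w₀ w₁
  have v₁ := mem₁ q₀ w₀ w₁
  have hqb : q₁ ∈ T₀ ∧ b ∈ T₁ ∧ b ∉ T₀ ∧ q₁ ∉ T₁ ∨ b ∈ T₀ ∧ q₁ ∈ T₁ ∧ q₁ ∉ T₀ ∧ b ∉ T₁ := by
    grind
  have hqb' : R u₀ q₁ ↔ ¬ R u₀ b := by
    rcases hqb with h | h
    · have := (f₃ q₁ h.1 (.inl rfl)).2 u₀
      have := (g₃ b h.2.1 (.inr rfl)).2 u₀
      grind
    · have := (g₃ q₁ h.2.1 (.inl rfl)).2 u₀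
      have := (f₃ b h.1 (.inr rfl)).2 u₀
      grind
  have t₀ : q₀ ∈ T₀ ∧ w₁ ∈ T₀ ∧ p ∈ S₀ := by
    have := mem₀ q₁ w₀ w₁
    have := mem₀ b w₀ w₁
    have := mem₀ q₁ w₀ q₀
    have := mem₀ b w₀ q₀
    have := f₃ q₁
    have := f₃ b
    grind
  have t₁ : q₀ ∈ T₁ ∧ w₁ ∈ T₁ := by
    have := mem₁ q₁ w₀ w₁
    have := mem₁ b w₀ w₁
    have := mem₁ q₁ w₀ q₀
    have := mem₁ b w₀ q₀
    grind
  have j₀ := (f₄ w₁ t₀.2.1 (.inr rfl)).2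
  have j₁ := (g₄ w₁ t₁.2 (.inr rfl)).2
  have hZ : a ∈ S₀ ∨ a ∈ S₁ := by
    by_contra! hc
    have hs : Finset.univ.filter (fun z => R z q₀) ⊆ insert p (S₀ᶜ.erase u₁) := by
      intro z hz
      have hz' : R z q₀ := by simpa using hz
      have := f₅ t₀.1 z hz'
      have := g₅ t₁.1 z hz'
      simp only [Finset.mem_insert, Finset.mem_erase, Finset.mem_compl]
      grind
    have c₁ := (Finset.card_le_card hs).trans (Finset.card_insert_le _ _)
    have c₂ : (S₀ᶜ.erase u₁).card = 2 := by
      rw [Finset.card_erase_of_mem (by simpa using i₀.2), Finset.card_compl, f₆]; rfl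
    have c₃ : 4 ≤ (Finset.univ.filter (fun z => R z q₀)).card := by convert hR' q₀
    omega
  have n : ¬ HasPM R fun s t => (s = p ∧ t = q₀) ∨ (s = p ∧ t = q₁) ∨ (s = u₀ ∧ t = w₀) ∨
      (s = u₁ ∧ t = w₀) ∨ (s = p ∧ t = b) ∨ (s = a ∧ t = q₀) := by
    intro h
    refine hG ⟨(_, _), (_, _), (_, _), (_, _), (_, _), (_, _), ⟨h₁, h₂, k₀, l₀⟩, ?_,
      ⟨?_, m₁, m₂⟩, h⟩
    · simp only [IsP3, VDisj]; grind
    · grind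
  rcases obstr_of_not_hasPM hR hR' n
    ⟨p, a, q₀, q₁, b, q₀, q₀, by grind (splits := 20), by grind (splits := 20),
      by grind (splits := 20)⟩
    ⟨q₀, w₀, p, a, a, u₀, u₁, by grind (splits := 20), by grind (splits := 20),
      by grind (splits := 20)⟩ with
    ⟨S, T, h⟩ | ⟨T, S, h⟩
  · have hS : ∀ s ∈ S, s = p ∨ s = a ∨ s = u₀ ∨ s = u₁ := by
      intro s hs
      have := h.exists_mem hR s hs
      grind
    have e₁ : a ∈ S := by have := h.exists_ne p u₀ u₁; grind
    have e₂ : u₀ ∈ S := by have := h.exists_ne p a u₁; grind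
    have r₁ := (h.adj hR (c := q₀) e₁ (by grind)).2 w₁
    have r₂ := (h.adj hR (c := w₀) e₂ (by grind)).2 w₁
    have := j₀ a
    have := j₁ a
    have := hCR _ _ l₁
    grind
  · have hT : ∀ t ∈ T, t = q₀ ∨ t = q₁ ∨ t = b ∨ t = w₀ := by
      intro s hs
      have := h.exists_mem hR' s hs
      grind
    have e₁ : q₁ ∈ T := by have := h.exists_ne q₀ b w₀; grind
    have e₂ : b ∈ T := by have := h.exists_ne q₀ q₁ w₀; grind
    have r₁ := (h.adj hR' (c := p) e₁ (by grind)).2 u₀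
    have r₂ := (h.adj hR' (c := p) e₂ (by grind)).2 u₀
    grind

/-- If removing the double star with centres `a` and `b` leaves an obstruction on the left,
then moving one of the paths gives a good configuration. -/
theorem isGood_of_obstr_cross {R C Mt L : Fin 8 → Fin 8 → Prop} (hR : DegFour R)
    (hR' : DegFour (fun b a => R a b)) (hCR : ∀ a b, C a b → R a b)
    {a a₁ a₂ a' b b₁ b₂ b₃ b' : Fin 8} (h₁ : C a b₁) (h₂ : C a b₂) (h₃ : C a₁ b)
    (h₄ : C a₁ b₃) (m₁ : Mt a b') (m₂ : Mt a' b)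
    (ha : a ≠ a₁ ∧ a ≠ a₂ ∧ a ≠ a') (haa : a₁ ≠ a₂) (hb : b ≠ b₁ ∧ b ≠ b₂ ∧ b ≠ b₃ ∧ b ≠ b')
    (hbb : b₁ ≠ b₂) (hb₃ : b₃ ≠ b₁ ∧ b₃ ≠ b₂)
    (hL : ∀ s t, L s t → s = a ∨ t = b ∧ (s = a₁ ∨ s = a₂ ∨ s = a'))
    {S T : Finset (Fin 8)} (h : Obstr R L S T) : IsGood R C Mt := by
  by_contra hG
  have hS : ∀ s ∈ S, s = a ∨ s = a₁ ∨ s = a₂ ∨ s = a' := by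
    intro s hs
    obtain ⟨t, -, -, ht⟩ := h.exists_mem hR s hs
    have := hL s t ht
    grind
  have e₁ : a₁ ∈ S := by have := h.exists_ne a a₂ a'; grind
  have e₂ : a₂ ∈ S := by have := h.exists_ne a a₁ a'; grind
  have e₃ : a' ∈ S ∧ a' ≠ a₁ ∧ a' ≠ a₂ := by have := h.exists_ne a a₁ a₂; grind
  have r₁ := h.adj hR e₁ (c := b) fun t ht => by have := hL _ _ ht; grind
  have r₂ := (h.adj hR e₂ (c := b) fun t ht => by have := hL _ _ ht; grind).2
  have r₃ := (h.adj hR e₃.1 (c := b) fun t ht => by have := hL _ _ ht; grind).2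
  have hb₃T : b₃ ∉ T := by have := (r₁.2 b₃).1 (hCR _ _ h₄); grind
  have n : ¬ HasPM R fun s t => (s = a ∧ t = b₁) ∨ (s = a ∧ t = b₂) ∨ (s = a₁ ∧ t = b) ∨
      (s = a₁ ∧ t = b₃) ∨ (s = a ∧ t = b') ∨ (s = a' ∧ t = b) := by
    intro h
    refine hG ⟨(_, _), (_, _), (_, _), (_, _), (_, _), (_, _), ⟨h₁, h₂, h₃, h₄⟩, ?_,
      ⟨?_, m₁, m₂⟩, h⟩
    · simp only [IsP3, VDisj]; grind
    · grind
  rcases obstr_of_not_hasPM hR hR' n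
    ⟨a, a₁, b₁, b₂, b', b, b₃, by grind (splits := 20), by grind (splits := 20),
      by grind (splits := 20)⟩
    ⟨b, b₃, a₁, a', a', a₁, a, by grind (splits := 20), by grind (splits := 20),
      by grind (splits := 20)⟩ with
    ⟨S', T', h'⟩ | ⟨T', S', h'⟩
  · obtain ⟨s, hs, hn⟩ := h'.exists_ne a a₁ a'
    have := h'.exists_mem hR s hs
    grind
  · have hT : ∀ t ∈ T', t = b₁ ∨ t = b₂ ∨ t = b' ∨ t = b ∨ t = b₃ := by
      intro s hs
      have := h'.exists_mem hR' s hs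
      grind
    have i₂ : a₂ ∉ S' := by
      intro hc
      obtain ⟨t, ht, hn⟩ := h'.exists_ne b₁ b₂ b'
      have := h'.within t ht a₂ hc
      grind
    have col : ∀ t ∈ T', t ≠ b → t ≠ b₃ → t ∉ T ∧ ∀ z, R z t ↔ z ∉ S' ∨ z = a := by
      intro t ht n₁ n₂
      have := (h'.adj hR' (c := a) ht (by grind)).2
      exact ⟨by have := this a₂; have := r₂ t; grind, this⟩
    have hs : insert b₃ (T'.erase b) ⊆ Tᶜ := by
      intro z hz
      simp only [Finset.mem_insert, Finset.mem_erase] at hz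
      have := col z
      simp only [Finset.mem_compl]
      grind
    have hc := Finset.card_le_card hs
    rw [Finset.card_compl, h.cardT, Fintype.card_fin] at hc
    have j₁ : b ∈ T' := by
      by_contra hn
      rw [Finset.erase_eq_of_notMem hn] at hc
      have := Finset.card_le_card (Finset.subset_insert b₃ T')
      have := h'.cardS
      omega
    have j₂ : b₃ ∈ T' := by
      by_contra hn
      rw [Finset.card_insert_of_notMem (by simp [hn]), Finset.card_erase_of_mem j₁,
        h'.cardS] at hc
      omega
    obtain ⟨t, ht, n₁, n₂, -⟩ := h'.exists_ne b b₃ b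
    have k := col t ht n₁ n₂
    have k₁ := k.2 a₁
    have k₂ := k.2 a'
    have k₃ := r₁.2 t
    have k₄ := r₃ t
    have := h'.exists_mem hR' b j₁
    grind

/-- Two edges of `Mt` each joining one of the two vertices `a`, `b` on different cycles. -/
theorem isGood_of_cross {R C Mt : Fin 8 → Fin 8 → Prop} (hR : DegFour R)
    (hR' : DegFour (fun b a => R a b)) (hCR : ∀ a b, C a b → R a b)
    {a a₁ a₂ a₃ a' b b₁ b₂ b₃ b' : Fin 8}
    (h₁ : C a b₁) (h₂ : C a b₂) (h₃ : C a₁ b) (h₄ : C a₂ b) (h₅ : C a₁ b₃) (h₆ : C a₃ b₁)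
    (m₁ : Mt a b') (m₂ : Mt a' b)
    (ha : a ≠ a₁ ∧ a ≠ a₂ ∧ a ≠ a₃ ∧ a ≠ a') (haa : a₁ ≠ a₂) (ha₃ : a₃ ≠ a₁ ∧ a₃ ≠ a₂)
    (hb : b ≠ b₁ ∧ b ≠ b₂ ∧ b ≠ b₃ ∧ b ≠ b') (hbb : b₁ ≠ b₂) (hb₃ : b₃ ≠ b₁ ∧ b₃ ≠ b₂) :
    IsGood R C Mt := by
  by_contra hG
  have n : ¬ HasPM R fun s t => (s = a ∧ t = b₁) ∨ (s = a ∧ t = b₂) ∨ (s = a₁ ∧ t = b) ∨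
      (s = a₂ ∧ t = b) ∨ (s = a ∧ t = b') ∨ (s = a' ∧ t = b) := by
    intro h
    refine hG ⟨(_, _), (_, _), (_, _), (_, _), (_, _), (_, _), ⟨h₁, h₂, h₃, h₄⟩, ?_,
      ⟨?_, m₁, m₂⟩, h⟩
    · simp only [IsP3, VDisj]; grind
    · grind
  rcases obstr_of_not_hasPM hR hR' n
    ⟨a, a₁, b₁, b₂, b', b, b, by grind (splits := 20), by grind (splits := 20),
      by grind (splits := 20)⟩
    ⟨b, b₁, a₁, a₂, a', a, a, by grind (splits := 20), by grind (splits := 20),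
      by grind (splits := 20)⟩ with
    ⟨S, T, h⟩ | ⟨T, S, h⟩
  · exact hG (isGood_of_obstr_cross hR hR' hCR h₁ h₂ h₃ h₅ m₁ m₂ ⟨ha.1, ha.2.1, ha.2.2.2⟩ haa
      hb hbb hb₃ (by grind (splits := 20)) h)
  · exact hG (isGood_of_obstr_cross (C := fun b a => C a b) (Mt := fun b a => Mt a b) hR' hR
      (fun _ _ => hCR _ _) h₃ h₄ h₁ h₆ m₂ m₁ ⟨hb.1, hb.2.1, hb.2.2.2⟩ hbb ha haa ha₃
      (by grind (splits := 20)) h).flip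

/-- `C` is the disjoint union of the 6-cycle `x₀ y₀ x₁ y₁ x₂ y₂` and the 4-cycle `u₀ w₀ u₁ w₁`,
and `Mt` is a matching covering at least two vertices of `C` on each side. -/
structure Setup (R C Mt : Fin 8 → Fin 8 → Prop) (x₀ x₁ x₂ y₀ y₁ y₂ u₀ u₁ w₀ w₁ : Fin 8) :
    Prop where
  deg : DegFour R
  deg' : DegFour fun b a => R a b
  le : ∀ a b, C a b → R a b
  hexagon : C x₀ y₀ ∧ C x₁ y₀ ∧ C x₁ y₁ ∧ C x₂ y₁ ∧ C x₂ y₂ ∧ C x₀ y₂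
  square : C u₀ w₀ ∧ C u₁ w₀ ∧ C u₁ w₁ ∧ C u₀ w₁
  hx : x₀ ≠ x₁ ∧ x₀ ≠ x₂ ∧ x₁ ≠ x₂
  hy : y₀ ≠ y₁ ∧ y₀ ≠ y₂ ∧ y₁ ≠ y₂
  hu : u₀ ≠ u₁ ∧ u₀ ≠ x₀ ∧ u₀ ≠ x₁ ∧ u₀ ≠ x₂ ∧ u₁ ≠ x₀ ∧ u₁ ≠ x₁ ∧ u₁ ≠ x₂
  hw : w₀ ≠ w₁ ∧ w₀ ≠ y₀ ∧ w₀ ≠ y₁ ∧ w₀ ≠ y₂ ∧ w₁ ≠ y₀ ∧ w₁ ≠ y₁ ∧ w₁ ≠ y₂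
  right_unique : ∀ a b b', Mt a b → Mt a b' → b = b'
  left_unique : ∀ a a' b, Mt a b → Mt a' b → a = a'
  cover_left : ∀ c, ∃ a b, Mt a b ∧ a ≠ c ∧ (a = x₀ ∨ a = x₁ ∨ a = x₂ ∨ a = u₀ ∨ a = u₁)
  cover_right : ∀ c, ∃ a b, Mt a b ∧ b ≠ c ∧ (b = y₀ ∨ b = y₁ ∨ b = y₂ ∨ b = w₀ ∨ b = w₁)

namespace Setup

variable {R C Mt : Fin 8 → Fin 8 → Prop} {x₀ x₁ x₂ y₀ y₁ y₂ u₀ u₁ w₀ w₁ : Fin 8}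

theorem rotate (h : Setup R C Mt x₀ x₁ x₂ y₀ y₁ y₂ u₀ u₁ w₀ w₁) :
    Setup R C Mt x₁ x₂ x₀ y₁ y₂ y₀ u₀ u₁ w₀ w₁ := by
  refine ⟨h.deg, h.deg', h.le, ?_, h.square, ?_, ?_, ?_, ?_, h.right_unique, h.left_unique,
    fun c => let ⟨a, b, m, n, o⟩ := h.cover_left c; ⟨a, b, m, n, by tauto⟩,
    fun c => let ⟨a, b, m, n, o⟩ := h.cover_right c; ⟨a, b, m, n, by tauto⟩⟩
  · have := h.hexagon; tauto
  · have := h.hx; grind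
  · have := h.hy; grind
  · have := h.hu; tauto
  · have := h.hw; tauto

theorem reflect (h : Setup R C Mt x₀ x₁ x₂ y₀ y₁ y₂ u₀ u₁ w₀ w₁) :
    Setup R C Mt x₁ x₀ x₂ y₀ y₂ y₁ u₀ u₁ w₀ w₁ := by
  refine ⟨h.deg, h.deg', h.le, ?_, h.square, ?_, ?_, ?_, ?_, h.right_unique, h.left_unique,
    fun c => let ⟨a, b, m, n, o⟩ := h.cover_left c; ⟨a, b, m, n, by tauto⟩,
    fun c => let ⟨a, b, m, n, o⟩ := h.cover_right c; ⟨a, b, m, n, by tauto⟩⟩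
  · have := h.hexagon; tauto
  · have := h.hx; grind
  · have := h.hy; grind
  · have := h.hu; tauto
  · have := h.hw; tauto

theorem swap_left (h : Setup R C Mt x₀ x₁ x₂ y₀ y₁ y₂ u₀ u₁ w₀ w₁) :
    Setup R C Mt x₀ x₁ x₂ y₀ y₁ y₂ u₁ u₀ w₀ w₁ := by
  refine ⟨h.deg, h.deg', h.le, h.hexagon, ?_, h.hx, h.hy, ?_, h.hw, h.right_unique,
    h.left_unique, fun c => let ⟨a, b, m, n, o⟩ := h.cover_left c; ⟨a, b, m, n, by tauto⟩,
    h.cover_right⟩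
  · have := h.square; tauto
  · have := h.hu; grind

theorem swap_right (h : Setup R C Mt x₀ x₁ x₂ y₀ y₁ y₂ u₀ u₁ w₀ w₁) :
    Setup R C Mt x₀ x₁ x₂ y₀ y₁ y₂ u₀ u₁ w₁ w₀ := by
  refine ⟨h.deg, h.deg', h.le, h.hexagon, ?_, h.hx, h.hy, h.hu, ?_, h.right_unique,
    h.left_unique, h.cover_left,
    fun c => let ⟨a, b, m, n, o⟩ := h.cover_right c; ⟨a, b, m, n, by tauto⟩⟩
  · have := h.square; tauto
  · have := h.hw; grind

theorem flip (h : Setup R C Mt x₀ x₁ x₂ y₀ y₁ y₂ u₀ u₁ w₀ w₁) :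
    Setup (fun b a => R a b) (fun b a => C a b) (fun b a => Mt a b)
      y₀ y₁ y₂ x₁ x₂ x₀ w₀ w₁ u₀ u₁ := by
  refine ⟨h.deg', h.deg, fun _ _ => h.le _ _, ?_, ?_, ?_, ?_, ?_, ?_,
    fun _ _ _ => h.left_unique _ _ _, fun _ _ _ => h.right_unique _ _ _,
    fun c => let ⟨a, b, m, n, o⟩ := h.cover_right c; ⟨b, a, m, n, o⟩,
    fun c => let ⟨a, b, m, n, o⟩ := h.cover_left c; ⟨b, a, m, n, by tauto⟩⟩
  · have := h.hexagon; tauto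
  · have := h.square; tauto
  · exact h.hy
  · have := h.hx; grind
  · exact h.hw
  · have := h.hu; tauto

theorem eq_of_cross (h : Setup R C Mt x₀ x₁ x₂ y₀ y₁ y₂ u₀ u₁ w₀ w₁) (hG : ¬ IsGood R C Mt)
    {a a' b b' : Fin 8} (ha : a = x₀ ∨ a = x₁ ∨ a = x₂) (hb : b = w₀ ∨ b = w₁) (m₁ : Mt a b')
    (m₂ : Mt a' b) : a = a' := by
  have key : ∀ {x₀ x₁ x₂ y₀ y₁ y₂ u₀ u₁ w₀ w₁}, Setup R C Mt x₀ x₁ x₂ y₀ y₁ y₂ u₀ u₁ w₀ w₁ →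
      Mt x₀ b' → Mt a' w₀ → x₀ = a' := by
    intro x₀ x₁ x₂ y₀ y₁ y₂ u₀ u₁ w₀ w₁ h m₁ m₂
    by_contra hn
    have hx := h.hx
    have hy := h.hy
    have hu := h.hu
    have hw := h.hw
    have hb : w₀ ≠ b' := by
      rintro rfl
      exact hn (h.left_unique _ _ _ m₁ m₂)
    exact hG (isGood_of_cross (a₂ := u₁) h.deg h.deg' h.le h.hexagon.1 h.hexagon.2.2.2.2.2
      h.square.1 h.square.2.1 h.square.2.2.2 h.hexagon.2.1 m₁ m₂ (by grind) (by grind) (by grind)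
      (by grind) (by grind) (by grind))
  rcases ha with rfl | rfl | rfl <;> rcases hb with rfl | rfl
  · exact key h m₁ m₂
  · exact key h.swap_right m₁ m₂
  · exact key h.rotate m₁ m₂
  · exact key h.rotate.swap_right m₁ m₂
  · exact key h.rotate.rotate m₁ m₂
  · exact key h.rotate.rotate.swap_right m₁ m₂

theorem isGood_of_crossing (h : Setup R C Mt x₀ x₁ x₂ y₀ y₁ y₂ u₀ u₁ w₀ w₁) {a b c : Fin 8}
    (ha : a = x₀ ∨ a = x₁ ∨ a = x₂) (hb : b = y₀ ∨ b = y₁ ∨ b = y₂) (hc : c = w₀ ∨ c = w₁)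
    (m₁ : Mt a c) (m₂ : Mt u₀ b) : IsGood R C Mt := by
  have key : ∀ {x₀ x₁ x₂ y₀ y₁ y₂ u₀ u₁ w₀ w₁}, Setup R C Mt x₀ x₁ x₂ y₀ y₁ y₂ u₀ u₁ w₀ w₁ →
      (b = y₀ ∨ b = y₁ ∨ b = y₂) → Mt x₀ w₀ → Mt u₀ b → IsGood R C Mt := by
    intro x₀ x₁ x₂ y₀ y₁ y₂ u₀ u₁ w₀ w₁ h hb m₁ m₂
    have hx := h.hx
    have hy := h.hy
    have hu := h.hu
    have hw := h.hw
    rcases hb with rfl | rfl | rfl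
    · exact isGood_of_crossing_adjacent (u' := u₁) h.deg h.deg' h.hexagon.1 h.hexagon.2.2.2.2.2
        h.square.1 h.square.2.1 m₁ m₂ (by grind) (by grind)
    · exact isGood_of_crossing_opposite h.deg h.deg' h.le h.hexagon.1 h.hexagon.2.2.2.2.2
        h.hexagon.2.2.1 h.hexagon.2.2.2.1 h.hexagon.2.1 h.hexagon.2.2.2.2.1 h.square.1
        h.square.2.2.2 h.square.2.1 m₁ m₂ hx hy hu hw
    · exact isGood_of_crossing_adjacent (u' := u₁) h.deg h.deg' h.hexagon.2.2.2.2.2 h.hexagon.1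
        h.square.1 h.square.2.1 m₁ m₂ (by grind) (by grind)
  rcases ha with rfl | rfl | rfl <;> rcases hc with rfl | rfl
  · exact key h hb m₁ m₂
  · exact key h.swap_right hb m₁ m₂
  · exact key h.rotate (by grind) m₁ m₂
  · exact key h.rotate.swap_right (by grind) m₁ m₂
  · exact key h.rotate.rotate (by grind) m₁ m₂
  · exact key h.rotate.rotate.swap_right (by grind) m₁ m₂

/-- Both sides of the 6-cycle and the left side of the 4-cycle are covered. -/
theorem isGood_of_mixed (h : Setup R C Mt x₀ x₁ x₂ y₀ y₁ y₂ u₀ u₁ w₀ w₁) {a a' b b' c c' : Fin 8}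
    (ha : a = x₀ ∨ a = x₁ ∨ a = x₂) (hb : b = y₀ ∨ b = y₁ ∨ b = y₂) (hc : c = u₀ ∨ c = u₁)
    (m₁ : Mt a b') (m₂ : Mt a' b) (m₃ : Mt c c') : IsGood R C Mt := by
  by_contra hG
  have hG' : ¬ IsGood (fun b a => R a b) (fun b a => C a b) (fun b a => Mt a b) := fun h =>
    hG h.flip
  have hu : ∀ {b a'}, b = y₀ ∨ b = y₁ ∨ b = y₂ → Mt a' b → Mt c b := by
    intro b a' hb m
    exact h.flip.eq_of_cross hG' hb hc m m₃ ▸ m₃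
  have m₂' := hu hb m₂
  obtain ⟨d, e, m, hne, he⟩ := h.cover_right b
  have he' : e = w₀ ∨ e = w₁ := by
    by_contra hn
    have : e = y₀ ∨ e = y₁ ∨ e = y₂ := by grind
    exact hne (h.right_unique _ _ _ (hu this m) m₂')
  have := h.eq_of_cross hG ha he' m₁ m
  subst this
  rcases hc with rfl | rfl
  · exact hG (h.isGood_of_crossing ha hb he' m m₂')
  · exact hG (h.swap_left.isGood_of_crossing ha hb he' m m₂')

/-- The left side of the 6-cycle is not covered. -/
theorem isGood_of_uncovered_hexagon (h : Setup R C Mt x₀ x₁ x₂ y₀ y₁ y₂ u₀ u₁ w₀ w₁)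
    (hX : ∀ b, ¬ Mt x₀ b ∧ ¬ Mt x₁ b ∧ ¬ Mt x₂ b) : IsGood R C Mt := by
  by_contra hG
  have hG' : ¬ IsGood (fun b a => R a b) (fun b a => C a b) (fun b a => Mt a b) := fun h =>
    hG h.flip
  have hx := h.hx
  have hy := h.hy
  have hu := h.hu
  have hw := h.hw
  obtain ⟨b₀, k₀⟩ : ∃ b, Mt u₀ b := by obtain ⟨a, b, k, k'⟩ := h.cover_left u₁; grind
  obtain ⟨b₁, k₁⟩ : ∃ b, Mt u₁ b := by obtain ⟨a, b, k, k'⟩ := h.cover_left u₀; grind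
  have hY : ∀ a, ¬ Mt a y₀ ∧ ¬ Mt a y₁ ∧ ¬ Mt a y₂ := by
    have : ∀ a b, b = y₀ ∨ b = y₁ ∨ b = y₂ → ¬ Mt a b := by
      intro a b hb m
      have e₀ := h.flip.eq_of_cross hG' hb (.inl rfl) m k₀
      have e₁ := h.flip.eq_of_cross hG' hb (.inr rfl) m k₁
      exact hu.1 (h.left_unique _ _ b (e₀ ▸ k₀) (e₁ ▸ k₁))
    grind
  obtain ⟨a₀, l₀⟩ : ∃ a, Mt a w₀ := by obtain ⟨a, b, k, k'⟩ := h.cover_right w₁; grind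
  obtain ⟨a₁, l₁⟩ : ∃ a, Mt a w₁ := by obtain ⟨a, b, k, k'⟩ := h.cover_right w₀; grind
  have key : ∀ {w₀ w₁ a₁}, Setup R C Mt x₀ x₁ x₂ y₀ y₁ y₂ u₀ u₁ w₀ w₁ → Mt u₀ w₀ → Mt a₁ w₁ →
      False := by
    intro w₀ w₁ a₁ h k l
    have hw := h.hw
    have := h.right_unique _ _ w₁ k
    exact hG (isGood_of_edge_mem h.deg h.deg' h.le h.square.1 h.square.2.2.2 h.hexagon.1
      h.hexagon.2.2.2.2.2 h.hexagon.2.1 h.hexagon.2.2.1 k l (by grind) (by grind) (by grind)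
      (by grind) (by grind) (by grind) (by grind) (by grind) (by grind) (by grind))
  by_cases e₀ : b₀ = w₀
  · subst e₀
    exact key h k₀ l₁
  by_cases e₁ : b₀ = w₁
  · subst e₁
    exact key h.swap_right k₀ l₀
  have := hX w₀
  have := hY u₀
  have := h.right_unique u₀ b₀ w₀ k₀
  exact hG (isGood_of_center_leaf_hexagon h.deg h.deg' h.le h.square.1 h.square.2.2.2 k₀ l₀
    h.hexagon.1 h.hexagon.2.2.1 h.hexagon.2.2.2.2.1 h.hexagon.2.1 h.hexagon.2.2.2.1
    h.hexagon.2.2.2.2.2 hx hy hw.1 ⟨e₀, e₁⟩ (by grind) (by grind) (by grind) (by grind)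
    (by grind) (by grind))

/-- The 4-cycle is not covered. -/
theorem isGood_of_uncovered_square (h : Setup R C Mt x₀ x₁ x₂ y₀ y₁ y₂ u₀ u₁ w₀ w₁)
    (hU : ∀ b, ¬ Mt u₀ b ∧ ¬ Mt u₁ b) (hW : ∀ a, ¬ Mt a w₀ ∧ ¬ Mt a w₁) : IsGood R C Mt := by
  by_contra hG
  have hG' : ¬ IsGood (fun b a => R a b) (fun b a => C a b) (fun b a => Mt a b) := fun h =>
    hG h.flip
  have edge : ∀ {x₀ x₁ x₂ y₀ y₁ y₂}, Setup R C Mt x₀ x₁ x₂ y₀ y₁ y₂ u₀ u₁ w₀ w₁ →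
      ¬ Mt x₀ y₀ := by
    intro x₀ x₁ x₂ y₀ y₁ y₂ h m
    have hx := h.hx
    have hy := h.hy
    have hu := h.hu
    have hw := h.hw
    obtain ⟨a, b, k, hne, ha⟩ := h.cover_left x₀
    have hb : b ≠ y₀ := by
      rintro rfl
      exact hne (h.left_unique _ _ _ k m)
    have : a = x₁ ∨ a = x₂ := by have := hU b; grind
    rcases this with rfl | rfl
    · exact hG' (isGood_of_edge_mem (d₁ := u₁) (d₂ := u₁) h.deg' h.deg (fun _ _ => h.le _ _)
        h.hexagon.1 h.hexagon.2.1 h.square.1 h.square.2.1 h.square.2.2.2 h.square.2.2.1 m k hb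
        hne.symm (by grind) (by grind) (by grind) (by grind) (by grind) (by grind) (by grind)
        (by grind))
    · exact hG (isGood_of_edge_mem_of_opposite h.deg h.deg' h.le h.hexagon.1
        h.hexagon.2.2.2.2.2 h.hexagon.2.2.1 h.hexagon.2.2.2.1 h.hexagon.2.2.2.2.1 m k hx hy hb)
  have key : ∀ {x₀ x₁ x₂ y₀ y₁ y₂ b}, Setup R C Mt x₀ x₁ x₂ y₀ y₁ y₂ u₀ u₁ w₀ w₁ →
      ¬ Mt x₀ b := by
    intro x₀ x₁ x₂ y₀ y₁ y₂ b h m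
    have hx := h.hx
    have hy := h.hy
    have hu := h.hu
    have hw := h.hw
    have n₀ := edge h
    have n₁ := edge h.rotate.rotate.reflect
    have leaf : ∀ {q₀ q₁ a}, C x₀ q₀ → C x₀ q₁ → Mt a q₀ → q₀ ≠ q₁ → ¬ Mt x₀ q₀ → ¬ Mt x₀ q₁ →
        w₀ ≠ q₀ ∧ w₀ ≠ q₁ → w₁ ≠ q₀ ∧ w₁ ≠ q₁ → False := by
      intro q₀ q₁ a c₀ c₁ l hq e₀ e₁ hw₀ hw₁
      have := hU q₀
      have := hW x₀
      exact hG (isGood_of_center_leaf_square h.deg h.deg' h.le c₀ c₁ m l h.square.1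
        h.square.2.2.1 h.square.2.1 h.square.2.2.2 hu.1 hw.1 hq (by grind) (by grind) (by grind)
        (by grind) (by grind) (by grind))
    obtain ⟨a, b', k, hne, hb⟩ := h.cover_right y₁
    have : b' = y₀ ∨ b' = y₂ := by have := hW a; grind
    rcases this with rfl | rfl
    · exact leaf h.hexagon.1 h.hexagon.2.2.2.2.2 k (by grind) n₀ n₁ (by grind) (by grind)
    · exact leaf h.hexagon.2.2.2.2.2 h.hexagon.1 k (by grind) n₁ n₀ (by grind) (by grind)
  obtain ⟨a, b, k, -, ha⟩ := h.cover_left u₀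
  have := hU b
  have : a = x₀ ∨ a = x₁ ∨ a = x₂ := by grind
  rcases this with rfl | rfl | rfl
  · exact key h k
  · exact key h.rotate k
  · exact key h.rotate.rotate k

theorem isGood (h : Setup R C Mt x₀ x₁ x₂ y₀ y₁ y₂ u₀ u₁ w₀ w₁) : IsGood R C Mt := by
  by_cases hX : ∀ b, ¬ Mt x₀ b ∧ ¬ Mt x₁ b ∧ ¬ Mt x₂ b
  · exact h.isGood_of_uncovered_hexagon hX
  by_cases hY : ∀ a, ¬ Mt a y₀ ∧ ¬ Mt a y₁ ∧ ¬ Mt a y₂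
  · exact (h.flip.isGood_of_uncovered_hexagon hY).flip
  obtain ⟨a, b', ha, m₁⟩ : ∃ a b, (a = x₀ ∨ a = x₁ ∨ a = x₂) ∧ Mt a b := by
    push Not at hX
    grind
  obtain ⟨b, a', hb, m₂⟩ : ∃ b a, (b = y₀ ∨ b = y₁ ∨ b = y₂) ∧ Mt a b := by
    push Not at hY
    grind
  by_contra hG
  refine hG (h.isGood_of_uncovered_square (fun c => ⟨fun m => ?_, fun m => ?_⟩)
    fun c => ⟨fun m => ?_, fun m => ?_⟩)
  · exact hG (h.isGood_of_mixed ha hb (.inl rfl) m₁ m₂ m)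
  · exact hG (h.isGood_of_mixed ha hb (.inr rfl) m₁ m₂ m)
  · exact hG (h.flip.isGood_of_mixed hb (by grind) (.inl rfl) m₂ m₁ m).flip
  · exact hG (h.flip.isGood_of_mixed hb (by grind) (.inr rfl) m₂ m₁ m).flip

end Setup

theorem exists_common_value_ne {α β : Type*} [Fintype α] [Fintype β] {f : α → Fin 8}
    {g : β → Fin 8} (hf : Function.Injective f) (hg : Function.Injective g)
    (h : 10 ≤ Fintype.card α + Fintype.card β) (c : Fin 8) : ∃ i j, f i = g j ∧ f i ≠ c := by
  classical
  have h₁ := Finset.card_union_add_card_inter (Finset.univ.image f) (Finset.univ.image g)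
  rw [Finset.card_image_of_injective _ hf, Finset.card_image_of_injective _ hg,
    Finset.card_univ, Finset.card_univ] at h₁
  have h₂ := Finset.card_le_univ (Finset.univ.image f ∪ Finset.univ.image g)
  rw [Fintype.card_fin] at h₂
  obtain ⟨z, hz, hzc⟩ := Finset.exists_mem_ne
    (s := Finset.univ.image f ∩ Finset.univ.image g) (by omega) c
  simp only [Finset.mem_inter, Finset.mem_image, Finset.mem_univ, true_and] at hz
  obtain ⟨⟨i, rfl⟩, j, hj⟩ := hz
  exact ⟨i, j, hj.symm, hzc⟩

theorem stmt16 (N : Fin 8 → Finset (Fin 8))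
    (hA : ∀ x, 4 ≤ (N x).card)
    (hB : ∀ y : Fin 8, 4 ≤ (Finset.univ.filter (fun x => y ∈ N x)).card)
    -- `C` is a vertex-disjoint union of a 6-cycle `x 0 y 0 x 1 y 1 x 2 y 2`
    -- and a 4-cycle `u 0 w 0 u 1 w 1`
    (x : Fin 3 → Fin 8) (y : Fin 3 → Fin 8)
    (u : Fin 2 → Fin 8) (w : Fin 2 → Fin 8)
    (hx : Function.Injective x) (hy : Function.Injective y)
    (hu : Function.Injective u) (hw : Function.Injective w)
    (hxu : ∀ i j, x i ≠ u j) (hyw : ∀ i j, y i ≠ w j)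
    (hC1 : ∀ i, y i ∈ N (x i)) (hC2 : ∀ i, y i ∈ N (x (i + 1)))
    (hC3 : ∀ i, w i ∈ N (u i)) (hC4 : ∀ i, w i ∈ N (u (i + 1)))
    -- a matching `M` of size 5
    (M : Fin 5 → Fin 8 × Fin 8)
    (hMe : ∀ i, (M i).2 ∈ N (M i).1)
    (hMm : ∀ i j, i ≠ j → (M i).1 ≠ (M j).1 ∧ (M i).2 ≠ (M j).2) :
    ∃ J : Finset (Fin 8 × Fin 8),
      (∀ p ∈ J, p.2 ∈ N p.1) ∧
      -- J contains a 2P₃ from C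
      (∃ e₁ e₂ e₃ e₄ : Fin 8 × Fin 8,
        e₁ ∈ J ∧ e₂ ∈ J ∧ e₃ ∈ J ∧ e₄ ∈ J ∧
        ((∃ i : Fin 3, e₁ = (x i, y i) ∨ e₁ = (x (i + 1), y i)) ∨
          (∃ i : Fin 2, e₁ = (u i, w i) ∨ e₁ = (u (i + 1), w i))) ∧
        ((∃ i : Fin 3, e₂ = (x i, y i) ∨ e₂ = (x (i + 1), y i)) ∨
          (∃ i : Fin 2, e₂ = (u i, w i) ∨ e₂ = (u (i + 1), w i))) ∧
        ((∃ i : Fin 3, e₃ = (x i, y i) ∨ e₃ = (x (i + 1), y i)) ∨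
          (∃ i : Fin 2, e₃ = (u i, w i) ∨ e₃ = (u (i + 1), w i))) ∧
        ((∃ i : Fin 3, e₄ = (x i, y i) ∨ e₄ = (x (i + 1), y i)) ∨
          (∃ i : Fin 2, e₄ = (u i, w i) ∨ e₄ = (u (i + 1), w i))) ∧
        IsP3 e₁ e₂ ∧ IsP3 e₃ e₄ ∧
        VDisj e₁ e₃ ∧ VDisj e₁ e₄ ∧ VDisj e₂ e₃ ∧ VDisj e₂ e₄) ∧
      -- J contains a 2K₂ from M
      (∃ i j : Fin 5, i ≠ j ∧ M i ∈ J ∧ M j ∈ J) ∧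
      -- H − E(J) has a perfect matching
      (∃ f : Fin 8 ≃ Fin 8, ∀ z, f z ∈ N z ∧ (z, f z) ∉ J) := by
  let R : Fin 8 → Fin 8 → Prop := fun a b => b ∈ N a
  let C : Fin 8 → Fin 8 → Prop := fun a b =>
    (∃ i : Fin 3, (a, b) = (x i, y i) ∨ (a, b) = (x (i + 1), y i)) ∨
      ∃ i : Fin 2, (a, b) = (u i, w i) ∨ (a, b) = (u (i + 1), w i)
  let Mt : Fin 8 → Fin 8 → Prop := fun a b => ∃ i, M i = (a, b)
  have hM₁ : Function.Injective fun i => (M i).1 := fun i j hij => by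
    by_contra hn
    exact (hMm i j hn).1 hij
  have hM₂ : Function.Injective fun i => (M i).2 := fun i j hij => by
    by_contra hn
    exact (hMm i j hn).2 hij
  have hS : Setup R C Mt (x 0) (x 1) (x 2) (y 0) (y 1) (y 2) (u 0) (u 1) (w 0) (w 1) := by
    refine ⟨fun a => ?_, fun b => ?_, ?_, ?_, ?_, ?_, ?_, ?_, ?_, ?_, ?_, fun c => ?_,
      fun c => ?_⟩
    · convert hA a using 2
      ext b
      simp [R]
    · convert hB b using 2
      ext a
      simp [R]
    · rintro a b (⟨i, h | h⟩ | ⟨i, h | h⟩) <;> obtain ⟨rfl, rfl⟩ := Prod.mk.inj h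
      · exact hC1 i
      · exact hC2 i
      · exact hC3 i
      · exact hC4 i
    · exact ⟨.inl ⟨0, .inl rfl⟩, .inl ⟨0, .inr rfl⟩, .inl ⟨1, .inl rfl⟩, .inl ⟨1, .inr rfl⟩,
        .inl ⟨2, .inl rfl⟩, .inl ⟨2, .inr rfl⟩⟩
    · exact ⟨.inr ⟨0, .inl rfl⟩, .inr ⟨0, .inr rfl⟩, .inr ⟨1, .inl rfl⟩, .inr ⟨1, .inr rfl⟩⟩
    · exact ⟨hx.ne (by decide), hx.ne (by decide), hx.ne (by decide)⟩
    · exact ⟨hy.ne (by decide), hy.ne (by decide), hy.ne (by decide)⟩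
    · exact ⟨hu.ne (by decide), (hxu _ _).symm, (hxu _ _).symm, (hxu _ _).symm, (hxu _ _).symm,
        (hxu _ _).symm, (hxu _ _).symm⟩
    · exact ⟨hw.ne (by decide), (hyw _ _).symm, (hyw _ _).symm, (hyw _ _).symm, (hyw _ _).symm,
        (hyw _ _).symm, (hyw _ _).symm⟩
    · rintro a b b' ⟨i, hi⟩ ⟨j, hj⟩
      have : i = j := hM₁ (by simp [hi, hj])
      subst this
      exact (Prod.mk.inj (hi.symm.trans hj)).2
    · rintro a a' b ⟨i, hi⟩ ⟨j, hj⟩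
      have : i = j := hM₂ (by simp [hi, hj])
      subst this
      exact (Prod.mk.inj (hi.symm.trans hj)).1
    · obtain ⟨i, j, h, hc⟩ := exists_common_value_ne (hx.sumElim hu hxu) hM₁ (by simp) c
      refine ⟨_, _, ⟨j, rfl⟩, h ▸ hc, h ▸ ?_⟩
      rcases i with i | i <;> fin_cases i <;> simp
    · obtain ⟨i, j, h, hc⟩ := exists_common_value_ne (hy.sumElim hw hyw) hM₂ (by simp) c
      refine ⟨_, _, ⟨j, rfl⟩, h ▸ hc, h ▸ ?_⟩
      rcases i with i | i <;> fin_cases i <;> simp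
  obtain ⟨e₁, e₂, e₃, e₄, m₁, m₂, ⟨c₁, c₂, c₃, c₄⟩, hP, ⟨hne, ⟨i, hi⟩, j, hj⟩, f, hf⟩ :=
    hS.isGood
  have hi : M i = m₁ := hi
  have hj : M j = m₂ := hj
  refine ⟨{e₁, e₂, e₃, e₄, m₁, m₂}, fun p hp => ?_,
    ⟨e₁, e₂, e₃, e₄, by simp, by simp, by simp, by simp, c₁, c₂, c₃, c₄, hP⟩,
    ⟨i, j, fun h => hne ?_, by simp [hi], by simp [hj]⟩, f, fun z => ⟨(hf z).1, fun h => ?_⟩⟩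
  · simp only [Finset.mem_insert, Finset.mem_singleton] at hp
    rcases hp with rfl | rfl | rfl | rfl | rfl | rfl
    · exact hS.le _ _ c₁
    · exact hS.le _ _ c₂
    · exact hS.le _ _ c₃
    · exact hS.le _ _ c₄
    · exact hi ▸ hMe i
    · exact hj ▸ hMe j
  · rw [← hi, ← hj, h]
  · exact (hf z).2 (by simpa [Prod.ext_iff] using h)
end
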